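/- arXiv:1005.4509 — 2 statements merged into one kernel-verified Lean document; each statement's English description precedes it below -/
import Mathlib

section
/- Let α₀, α₁ ∈ C^∞(ℝ³) and let φ ∈ C^∞(ℝ × ℝ³) satisfy the homogeneous wave equation ∂_t²φ − Δφ = 0 on ℝ × ℝ³ with initial data φ(0,·) = α₀ and ∂_tφ(0,·) = α₁. Then for every t > 0 and x ∈ ℝ³, Kirchhoff's formula holds: φ(t,x) = (1/(4πt²)) ∫_{∂B(x,t)} [ t·α₁(y) + α₀(y) + (y − x)·∇α₀(y) ] dσ(y). -/
open MeasureTheory Metric Real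
open scoped RealInnerProductSpace

noncomputable section

abbrev E3 := EuclideanSpace ℝ (Fin 3)

/-- The surface measure on the unit sphere `S² ⊆ ℝ³` (total mass `4π`). -/
def sphMeasure : Measure (sphere (0 : E3) 1) := (volume : Measure E3).toSphere

/-- Laplacian of `f : ℝ³ → ℝ`. -/
def lap (f : E3 → ℝ) (x : E3) : ℝ :=
  ∑ i : Fin 3,
    fderiv ℝ (fun y => fderiv ℝ f y (EuclideanSpace.single i (1:ℝ))) x
      (EuclideanSpace.single i (1:ℝ))

/-- Surface integral `∫_{∂B(x,r)} f dσ`, written in the spherical parametrization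
`y = x + r ω`, `ω ∈ S²`, with area element `r² dσ(ω)`. -/
def sphereIntegral (x : E3) (r : ℝ) (f : E3 → ℝ) : ℝ :=
  r ^ 2 * ∫ ω : sphere (0 : E3) 1, f (x + r • (ω : E3)) ∂sphMeasure

/-- Time derivative `∂_t φ`. -/
def dt (φ : ℝ × E3 → ℝ) (q : ℝ × E3) : ℝ := deriv (fun s => φ (s, q.2)) q.1

lemma param_deriv (F F' : ℝ → sphere (0 : E3) 1 → ℝ)
    (hF : ∀ s, Continuous (F s)) (hF' : Continuous (fun p : ℝ × sphere (0 : E3) 1 => F' p.1 p.2))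
    (hd : ∀ s ω, HasDerivAt (fun u => F u ω) (F' s ω) s) (s : ℝ) :
    HasDerivAt (fun u => ∫ ω, F u ω ∂sphMeasure) (∫ ω, F' s ω ∂sphMeasure) s := by
  have : IsFiniteMeasure sphMeasure := by unfold sphMeasure; infer_instance
  have hc : IsCompact ((closedBall s 1) ×ˢ (Set.univ : Set (sphere (0 : E3) 1))) :=
    (isCompact_closedBall s 1).prod isCompact_univ
  obtain ⟨C, hC⟩ := hc.exists_bound_of_continuousOn hF'.continuousOn
  have hcs : Continuous (F' s) := hF'.comp (by fun_prop : Continuous fun ω => (s, ω))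
  refine (hasDerivAt_integral_of_dominated_loc_of_deriv_le (bound := fun _ => C)
    (s := closedBall s 1) (closedBall_mem_nhds s one_pos) ?_ ?_ ?_ ?_ ?_ ?_).2
  · exact Filter.Eventually.of_forall fun u => (hF u).aestronglyMeasurable
  · exact (hF s).integrable_of_hasCompactSupport (HasCompactSupport.of_compactSpace _)
  · exact hcs.aestronglyMeasurable
  · exact Filter.Eventually.of_forall fun ω u hu => hC (u, ω) ⟨hu, Set.mem_univ _⟩
  · exact integrable_const C
  · exact Filter.Eventually.of_forall fun ω u hu => hd u ω

lemma sph_integrable (f : sphere (0 : E3) 1 → ℝ) (hf : Continuous f) :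
    Integrable f sphMeasure := by
  have : IsFiniteMeasure sphMeasure := by unfold sphMeasure; infer_instance
  exact hf.integrable_of_hasCompactSupport (HasCompactSupport.of_compactSpace _)

lemma sph_univ : sphMeasure.real Set.univ = 4 * π := by
  unfold sphMeasure
  rw [Measure.toSphere_real_apply_univ, measureReal_def, EuclideanSpace.volume_ball_fin_three]
  simp
  rw [ENNReal.toReal_ofReal (by positivity)]
  ring

/-- Linear isometry equivalence restricted to sphere. -/
def sphMap (L : E3 ≃ₗᵢ[ℝ] E3) (ω : sphere (0 : E3) 1) : sphere (0 : E3) 1 :=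
  ⟨L ω, by simp⟩

lemma sphMap_cont (L : E3 ≃ₗᵢ[ℝ] E3) : Continuous (sphMap L) := by
  unfold sphMap; exact Continuous.subtype_mk (L.continuous.comp continuous_subtype_val) _

open scoped Pointwise in
lemma sph_invariant (L : E3 ≃ₗᵢ[ℝ] E3) : MeasurePreserving (sphMap L) sphMeasure sphMeasure := by
  refine ⟨(sphMap_cont L).measurable, ?_⟩
  ext s hs
  rw [Measure.map_apply (sphMap_cont L).measurable hs]
  unfold sphMeasure
  rw [Measure.toSphere_apply' _ hs, Measure.toSphere_apply' _ ((sphMap_cont L).measurable hs)]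
  congr 1
  have hpre := L.measurePreserving.measure_preimage_equiv (f := L.toMeasurableEquiv)
    (Set.Ioo (0 : ℝ) 1 • ((fun w : sphere (0 : E3) 1 => (w : E3)) '' s))
  rw [← hpre]
  congr 1
  ext v
  simp only [Set.mem_smul, Set.mem_image, Set.mem_preimage]
  constructor
  · rintro ⟨a, ha, _, ⟨w, hw, rfl⟩, rfl⟩
    exact ⟨a, ha, _, ⟨sphMap L w, hw, rfl⟩, by simp [sphMap]⟩
  · rintro ⟨a, ha, _, ⟨w, hw, rfl⟩, h⟩
    refine ⟨a, ha, _, ⟨sphMap L.symm w, ?_, rfl⟩, ?_⟩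
    · have : sphMap L (sphMap L.symm w) = w := by ext1; simp [sphMap]
      rw [this]; exact hw
    · apply L.injective
      simpa [sphMap] using h

/-- rotation generator -/
def gen (i j : Fin 3) : E3 →L[ℝ] E3 :=
  (EuclideanSpace.proj i : E3 →L[ℝ] ℝ).smulRight (EuclideanSpace.single j (1:ℝ)) -
  (EuclideanSpace.proj j : E3 →L[ℝ] ℝ).smulRight (EuclideanSpace.single i (1:ℝ))

lemma gen_apply (i j : Fin 3) (v : E3) : gen i j v =
    v i • EuclideanSpace.single j (1:ℝ) - v j • EuclideanSpace.single i (1:ℝ) := by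
  simp [gen]

lemma rot_norm (i j : Fin 3) (hij : i ≠ j) (θ : ℝ) (v : E3) :
    ‖v + sin θ • gen i j v + (1 - cos θ) • gen i j (gen i j v)‖ = ‖v‖ := by
  have h : ‖v + sin θ • gen i j v + (1 - cos θ) • gen i j (gen i j v)‖ ^ 2 = ‖v‖ ^ 2 := by
    have hs := sin_sq_add_cos_sq θ
    generalize sin θ = s at *
    generalize cos θ = c at *
    have hs' : s ^ 2 = 1 - c ^ 2 := by linarith
    rw [EuclideanSpace.real_norm_sq_eq, EuclideanSpace.real_norm_sq_eq]
    fin_cases i <;> fin_cases j <;> first | exact absurd rfl hij | skip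
    all_goals
      simp [Fin.sum_univ_three, gen_apply]
      ring_nf
      rw [hs']
      ring
  exact (pow_left_inj₀ (norm_nonneg _) (norm_nonneg _) two_ne_zero).1 h

def rot (i j : Fin 3) (hij : i ≠ j) (θ : ℝ) : E3 →ₗᵢ[ℝ] E3 where
  toFun v := v + sin θ • gen i j v + (1 - cos θ) • gen i j (gen i j v)
  map_add' v w := by simp only [map_add, smul_add]; abel
  map_smul' c v := by
    simp only [map_smul, smul_add, RingHom.id_apply, smul_comm (sin θ) c, smul_comm (1 - cos θ) c]
  norm_map' v := rot_norm i j hij θ v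

lemma rot_integral (i j : Fin 3) (hij : i ≠ j) (θ : ℝ) (f : E3 → ℝ) (hf : Continuous f) :
    ∫ ω : sphere (0 : E3) 1, f ((ω : E3) + sin θ • gen i j ω + (1 - cos θ) • gen i j (gen i j ω))
      ∂sphMeasure = ∫ ω : sphere (0 : E3) 1, f ω ∂sphMeasure := by
  let L := (rot i j hij θ).toLinearIsometryEquiv rfl
  have h := (sph_invariant L)
  have h2 := integral_map h.measurable.aemeasurable (μ := sphMeasure) (f := fun ω : sphere (0 : E3) 1 => f ω)
    (hf.comp continuous_subtype_val).aestronglyMeasurable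
  rw [h.map_eq] at h2
  exact h2.symm

lemma gen_integral (i j : Fin 3) (hij : i ≠ j) (f : E3 → ℝ) (hf : ContDiff ℝ 1 f) (x : E3)
    (r : ℝ) :
    ∫ ω : sphere (0 : E3) 1, fderiv ℝ f (x + r • (ω : E3)) (r • gen i j ω) ∂sphMeasure = 0 := by
  have hfc := hf.continuous
  have hf' : Continuous (fderiv ℝ f) := hf.continuous_fderiv (by simp)
  have key := param_deriv
    (fun θ ω => f (x + r • ((ω : E3) + sin θ • gen i j ω + (1 - cos θ) • gen i j (gen i j ω))))
    (fun θ ω => fderiv ℝ f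
      (x + r • ((ω : E3) + sin θ • gen i j ω + (1 - cos θ) • gen i j (gen i j ω)))
      (r • (cos θ • gen i j ω + sin θ • gen i j (gen i j ω))))
    (fun s => by fun_prop)
    (by
      refine Continuous.clm_apply (hf'.comp (by fun_prop)) (by fun_prop))
    (fun s ω => by
      have h1 : HasDerivAt (fun θ : ℝ => x + r • ((ω : E3) + sin θ • gen i j ω +
          (1 - cos θ) • gen i j (gen i j ω)))
          (r • (cos s • gen i j ω + sin s • gen i j (gen i j ω))) s := by
        have a := (hasDerivAt_sin s).smul_const (gen i j (ω : E3))
        have b := ((hasDerivAt_cos s).const_sub 1).smul_const (gen i j (gen i j (ω : E3)))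
        have c := (((a.const_add (ω : E3)).add b).const_smul r).const_add x
        simpa using! c
      exact ((hf.differentiable (by simp)) _).hasFDerivAt.comp_hasDerivAt s h1) 0
  have hconst := fun θ => rot_integral i j hij θ (fun y => f (x + r • y)) (by fun_prop)
  simp only [hconst] at key
  have := key.unique (hasDerivAt_const 0 _)
  simpa using this

lemma lap_eq (g : E3 → ℝ) (hg : ContDiff ℝ (⊤ : ℕ∞) g) (y : E3) :
    lap g y = ∑ i : Fin 3, fderiv ℝ (fderiv ℝ g) y (EuclideanSpace.single i (1:ℝ))
      (EuclideanSpace.single i (1:ℝ)) := by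
  have h1 : Differentiable ℝ (fderiv ℝ g) :=
    (hg.fderiv_right (m := 1) (by norm_cast)).differentiable (by simp)
  unfold lap
  refine Finset.sum_congr rfl fun i _ => ?_
  rw [fderiv_clm_apply (h1 y) (differentiableAt_const _)]
  simp

lemma alg_identity (B : E3 →L[ℝ] E3 →L[ℝ] ℝ) (hB : ∀ v w, B v w = B w v) (D : E3 →L[ℝ] ℝ)
    (w : E3) (r : ℝ) (hw : ‖w‖ = 1) :
    (B (r • gen 0 1 w) (r • gen 0 1 w) + D (gen 0 1 (r • gen 0 1 w))) +
    (B (r • gen 0 2 w) (r • gen 0 2 w) + D (gen 0 2 (r • gen 0 2 w))) +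
    (B (r • gen 1 2 w) (r • gen 1 2 w) + D (gen 1 2 (r • gen 1 2 w))) =
    r ^ 2 * (∑ i : Fin 3, B (EuclideanSpace.single i (1:ℝ)) (EuclideanSpace.single i (1:ℝ)))
      - r ^ 2 * B w w - 2 * r * D w := by
  have hw2 : w 0 ^ 2 + w 1 ^ 2 + w 2 ^ 2 = 1 := by
    have := EuclideanSpace.real_norm_sq_eq w
    rw [hw, Fin.sum_univ_three] at this
    linarith
  have hexp : w = w 0 • EuclideanSpace.single 0 (1:ℝ) + w 1 • EuclideanSpace.single 1 (1:ℝ)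
      + w 2 • EuclideanSpace.single 2 (1:ℝ) := by
    ext k; fin_cases k <;> simp
  have hDw : D w = w 0 * D (EuclideanSpace.single 0 (1:ℝ)) + w 1 * D (EuclideanSpace.single 1 (1:ℝ))
      + w 2 * D (EuclideanSpace.single 2 (1:ℝ)) := by
    conv_lhs => rw [hexp]
    simp only [map_add, map_smul, smul_eq_mul]
  have hBw : B w w = ∑ i : Fin 3, ∑ j : Fin 3, w i * w j *
      B (EuclideanSpace.single i (1:ℝ)) (EuclideanSpace.single j (1:ℝ)) := by
    conv_lhs => rw [hexp]
    simp only [map_add, map_smul, smul_eq_mul, _root_.add_apply,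
      _root_.smul_apply, Fin.sum_univ_three]
    ring
  rw [hDw, hBw]
  simp only [gen_apply, map_add, map_sub, map_smul, smul_eq_mul, _root_.add_apply,
      _root_.sub_apply, _root_.smul_apply, Fin.sum_univ_three]
  rw [hB (EuclideanSpace.single 1 1) (EuclideanSpace.single 0 1),
    hB (EuclideanSpace.single 2 1) (EuclideanSpace.single 0 1),
    hB (EuclideanSpace.single 2 1) (EuclideanSpace.single 1 1)]
  simp
  generalize B (EuclideanSpace.single 0 1) (EuclideanSpace.single 0 1) = b00
  generalize B (EuclideanSpace.single 1 1) (EuclideanSpace.single 1 1) = b11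
  generalize B (EuclideanSpace.single 2 1) (EuclideanSpace.single 2 1) = b22
  linear_combination (-r ^ 2 * (b00 + b11 + b22)) * (-hw2)

lemma sph_lap (g : E3 → ℝ) (hg : ContDiff ℝ (⊤ : ℕ∞) g) (x : E3) (r : ℝ) :
    ∫ ω : sphere (0 : E3) 1, (r ^ 2 * lap g (x + r • (ω : E3))
      - r ^ 2 * fderiv ℝ (fderiv ℝ g) (x + r • (ω : E3)) ω ω
      - 2 * r * fderiv ℝ g (x + r • (ω : E3)) ω) ∂sphMeasure = 0 := by
  have hg1 : ContDiff ℝ 1 (fderiv ℝ g) := hg.fderiv_right (m := 1) (by norm_cast)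
  have hg1c := hg1.continuous
  have hg2c : Continuous (fderiv ℝ (fderiv ℝ g)) := hg1.continuous_fderiv (by simp)
  have hd : Differentiable ℝ (fderiv ℝ g) := hg1.differentiable (by simp)
  have hsym : ∀ y v w, fderiv ℝ (fderiv ℝ g) y v w = fderiv ℝ (fderiv ℝ g) y w v := fun y =>
    (hg.contDiffAt (x := y)).isSymmSndFDerivAt (by simp; norm_cast)
  have hI : ∀ i j : Fin 3, Integrable (fun ω : sphere (0 : E3) 1 =>
      fderiv ℝ (fderiv ℝ g) (x + r • (ω : E3)) (r • gen i j ω) (r • gen i j ω) +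
      fderiv ℝ g (x + r • (ω : E3)) (gen i j (r • gen i j ω))) sphMeasure := fun i j => by
    apply sph_integrable
    refine Continuous.add ?_ ?_
    · exact ((hg2c.comp (by fun_prop)).clm_apply (by fun_prop)).clm_apply (by fun_prop)
    · exact (hg1c.comp (by fun_prop)).clm_apply (by fun_prop)
  have key : ∀ i j : Fin 3, i ≠ j → ∫ ω : sphere (0 : E3) 1,
      (fderiv ℝ (fderiv ℝ g) (x + r • (ω : E3)) (r • gen i j ω) (r • gen i j ω) +
      fderiv ℝ g (x + r • (ω : E3)) (gen i j (r • gen i j ω))) ∂sphMeasure = 0 := by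
    intro i j hij
    have h := gen_integral i j hij (fun y => fderiv ℝ g y (gen i j (y - x)))
      (hg1.clm_apply (by fun_prop)) x r
    rw [← h]
    congr 1
    ext ω
    have hlin : ∀ y, HasFDerivAt (fun y : E3 => gen i j (y - x)) (gen i j) y := fun y =>
      (gen i j).hasFDerivAt.comp y ((hasFDerivAt_id y).sub_const x)
    rw [((hd _).hasFDerivAt.clm_apply (hlin _)).fderiv]
    simp
    ring
  have h3 := integral_add ((hI 0 1).add (hI 0 2)) (hI 1 2)
  refine Eq.trans ?_ (h3.trans ?_)
  · congr 1
    ext ω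
    rw [lap_eq g hg]
    exact (alg_identity _ (hsym _) _ _ r (by simp)).symm
  · rw [integral_add' (hI 0 1) (hI 0 2), key 0 1 (by decide), key 0 2 (by decide),
      key 1 2 (by decide)]
    simp

lemma dt_eq (φ : ℝ × E3 → ℝ) (hφ : ContDiff ℝ (⊤ : ℕ∞) φ) (q : ℝ × E3) :
    dt φ q = fderiv ℝ φ q (1, 0) := by
  have h : HasDerivAt (fun s : ℝ => (s, q.2)) (1, 0) q.1 :=
    (hasDerivAt_id q.1).prodMk (hasDerivAt_const _ _)
  exact ((hφ.differentiable (by simp) q).hasFDerivAt.comp_hasDerivAt q.1 h).deriv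

lemma dtt_eq (φ : ℝ × E3 → ℝ) (hφ : ContDiff ℝ (⊤ : ℕ∞) φ) (q : ℝ × E3) :
    dt (dt φ) q = fderiv ℝ (fderiv ℝ φ) q (1, 0) (1, 0) := by
  have h1 : ContDiff ℝ (⊤ : ℕ∞) (fderiv ℝ φ) := hφ.fderiv_right (by norm_cast)
  have : dt φ = fun q => fderiv ℝ φ q (1, 0) := funext (dt_eq φ hφ)
  rw [this, dt_eq _ (h1.clm_apply contDiff_const),
    fderiv_clm_apply (h1.differentiable (by simp) _) (differentiableAt_const _)]
  simp

lemma slice_fderiv {F : Type*} [NormedAddCommGroup F] [NormedSpace ℝ F] (φ : ℝ × E3 → F)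
    (hφ : ContDiff ℝ (⊤ : ℕ∞) φ) (t : ℝ) (y : E3) :
    fderiv ℝ (fun y => φ (t, y)) y = (fderiv ℝ φ (t, y)).comp (ContinuousLinearMap.inr ℝ ℝ E3) := by
  have h : HasFDerivAt (fun y : E3 => (t, y)) (ContinuousLinearMap.inr ℝ ℝ E3) y :=
    (hasFDerivAt_const t y).prodMk (hasFDerivAt_id y)
  exact ((hφ.differentiable (by simp) (t, y)).hasFDerivAt.comp y h).fderiv

lemma slice_fderiv2 (φ : ℝ × E3 → ℝ)
    (hφ : ContDiff ℝ (⊤ : ℕ∞) φ) (t : ℝ) (y v w : E3) :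
    fderiv ℝ (fderiv ℝ (fun y => φ (t, y))) y v w = fderiv ℝ (fderiv ℝ φ) (t, y) (0, v) (0, w) := by
  have h1 : ContDiff ℝ (⊤ : ℕ∞) (fderiv ℝ φ) := hφ.fderiv_right (by norm_cast)
  have h2 : fderiv ℝ (fun y => φ (t, y)) =
    fun y => (fderiv ℝ φ (t, y)).comp (ContinuousLinearMap.inr ℝ ℝ E3) :=
    funext (slice_fderiv φ hφ t)
  have h3 : Differentiable ℝ (fun y => fderiv ℝ φ (t, y)) :=
    (h1.differentiable (by simp)).comp (by fun_prop)
  rw [h2, fderiv_clm_comp (h3 y) (differentiableAt_const _), slice_fderiv _ h1]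
  simp

/-- **Kirchhoff's formula.**  If `φ ∈ C^∞(ℝ × ℝ³)` solves the homogeneous wave equation
`∂_t² φ − Δφ = 0` with initial data `φ(0,·) = α₀`, `∂_t φ(0,·) = α₁`, then for every `t > 0`
and `x ∈ ℝ³`,
`φ(t,x) = (1/(4πt²)) ∫_{∂B(x,t)} [ t α₁(y) + α₀(y) + ⟨y − x, ∇α₀(y)⟩ ] dσ(y)`. -/
theorem kirchhoff_formula
    (α₀ α₁ : E3 → ℝ) (φ : ℝ × E3 → ℝ)
    (hα₀ : ContDiff ℝ (⊤ : ℕ∞) α₀) (hα₁ : ContDiff ℝ (⊤ : ℕ∞) α₁) (hφ : ContDiff ℝ (⊤ : ℕ∞) φ)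
    (hwave : ∀ t : ℝ, ∀ x : E3, dt (dt φ) (t, x) - lap (fun y => φ (t, y)) x = 0)
    (hinit₀ : ∀ x : E3, φ (0, x) = α₀ x)
    (hinit₁ : ∀ x : E3, dt φ (0, x) = α₁ x) :
    ∀ t : ℝ, 0 < t → ∀ x : E3,
      φ (t, x) = (1 / (4 * π * t ^ 2)) *
        sphereIntegral x t (fun y => t * α₁ y + α₀ y + ⟪y - x, gradient α₀ y⟫) := by
  intro T hT x
  have h1 : ContDiff ℝ (⊤ : ℕ∞) (fderiv ℝ φ) := hφ.fderiv_right (by norm_cast)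
  have h2 : ContDiff ℝ (⊤ : ℕ∞) (fderiv ℝ (fderiv ℝ φ)) := h1.fderiv_right (by norm_cast)
  have hc0 := hφ.continuous
  have hc1 := h1.continuous
  have hc2 := h2.continuous
  have hsym : ∀ y v w, fderiv ℝ (fderiv ℝ φ) y v w = fderiv ℝ (fderiv ℝ φ) y w v := fun y =>
    (hφ.contDiffAt (x := y)).isSymmSndFDerivAt (by simp; norm_cast)
  set F : ℝ → sphere (0 : E3) 1 → ℝ := fun r ω =>
    φ (T - r, x + r • (ω : E3)) + r * fderiv ℝ φ (T - r, x + r • (ω : E3)) (1, (ω : E3)) with hFdef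
  set F' : ℝ → sphere (0 : E3) 1 → ℝ := fun r ω =>
    2 * fderiv ℝ φ (T - r, x + r • (ω : E3)) (0, (ω : E3)) +
    r * (fderiv ℝ (fderiv ℝ φ) (T - r, x + r • (ω : E3)) (0, (ω : E3)) (0, (ω : E3)) -
      fderiv ℝ (fderiv ℝ φ) (T - r, x + r • (ω : E3)) (1, 0) (1, 0)) with hF'def
  have hder : ∀ s, HasDerivAt (fun u => ∫ ω, F u ω ∂sphMeasure) (∫ ω, F' s ω ∂sphMeasure) s := by
    apply param_deriv
    · intro s
      refine (hc0.comp (by fun_prop)).add (continuous_const.mul ?_)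
      exact (hc1.comp (by fun_prop)).clm_apply (by fun_prop)
    · refine (continuous_const.mul ?_).add (continuous_fst.mul (Continuous.sub ?_ ?_))
      · exact (hc1.comp (by fun_prop)).clm_apply (by fun_prop)
      · exact ((hc2.comp (by fun_prop)).clm_apply (by fun_prop)).clm_apply (by fun_prop)
      · exact ((hc2.comp (by fun_prop)).clm_apply (by fun_prop)).clm_apply (by fun_prop)
    · intro s ω
      have hγ : HasDerivAt (fun r : ℝ => (T - r, x + r • (ω : E3))) (-1, (ω : E3)) s := by
        have a := (hasDerivAt_id s).const_sub T
        have b := ((hasDerivAt_id s).smul_const (ω : E3)).const_add x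
        simpa using! a.prodMk b
      have d0 := (hφ.differentiable (by simp) (T - s, x + s • (ω : E3))).hasFDerivAt.comp_hasDerivAt s hγ
      have d1 := (h1.differentiable (by simp) (T - s, x + s • (ω : E3))).hasFDerivAt.comp_hasDerivAt s hγ
      have d2 := d1.clm_apply (hasDerivAt_const s ((1 : ℝ), (ω : E3)))
      have d3 := d0.add ((hasDerivAt_id s).mul d2)
      refine d3.congr_deriv ?_
      have e1 : ((1 : ℝ), (ω : E3)) = (1, 0) + (0, (ω : E3)) := by simp
      have e2 : ((-1 : ℝ), (ω : E3)) = -(1, 0) + (0, (ω : E3)) := by simp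
      simp only [hF'def, Function.comp, id, e1, e2, map_add, map_neg, _root_.add_apply,
        _root_.neg_apply, map_zero, add_zero, one_mul]
      rw [hsym _ (0, (ω : E3)) (1, 0)]
      ring
  have hzero : ∀ r ∈ Set.Ioo 0 T, ∫ ω, F' r ω ∂sphMeasure = 0 := by
    intro r hr
    have hs := sph_lap (fun y => φ (T - r, y)) (hφ.comp (by fun_prop)) x r
    have : ∫ ω, (-r) * F' r ω ∂sphMeasure = 0 := by
      rw [← hs]
      congr 1
      ext ω
      have hw := hwave (T - r) (x + r • (ω : E3))
      rw [dtt_eq φ hφ] at hw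
      have hw' : lap (fun y => φ (T - r, y)) (x + r • (ω : E3)) =
        fderiv ℝ (fderiv ℝ φ) (T - r, x + r • (ω : E3)) (1, 0) (1, 0) := by linarith
      rw [hw', slice_fderiv2 φ hφ, slice_fderiv φ hφ]
      simp only [hF'def, ContinuousLinearMap.comp_apply, ContinuousLinearMap.inr_apply]
      ring
    rw [integral_const_mul] at this
    exact (mul_eq_zero.1 this).resolve_left (by linarith [hr.1])
  obtain ⟨c, hc, hslope⟩ := exists_hasDerivAt_eq_slope (fun u => ∫ ω, F u ω ∂sphMeasure)
    (fun u => ∫ ω, F' u ω ∂sphMeasure) hT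
    (fun u _ => (hder u).continuousAt.continuousWithinAt) (fun u _ => hder u)
  rw [hzero c hc, eq_comm, div_eq_zero_iff] at hslope
  have hEq : ∫ ω, F T ω ∂sphMeasure = ∫ ω, F 0 ω ∂sphMeasure := by
    rcases hslope with h | h
    · linarith
    · linarith
  have hF0 : ∫ ω, F 0 ω ∂sphMeasure = 4 * π * φ (T, x) := by
    simp [hFdef, sph_univ]
  have hFT : ∫ ω : sphere (0 : E3) 1, (fun y => T * α₁ y + α₀ y + ⟪y - x, gradient α₀ y⟫)
      (x + T • (ω : E3)) ∂sphMeasure = ∫ ω, F T ω ∂sphMeasure := by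
    congr 1
    ext ω
    have hα : α₀ = fun y => φ (0, y) := funext fun y => (hinit₀ y).symm
    have hg : ⟪x + T • (ω : E3) - x, gradient α₀ (x + T • (ω : E3))⟫ =
        T * fderiv ℝ φ (0, x + T • (ω : E3)) (0, (ω : E3)) := by
      rw [real_inner_comm, gradient, InnerProductSpace.toDual_symm_apply, hα,
        slice_fderiv φ hφ]
      simp only [add_sub_cancel_left, map_smul, smul_eq_mul, ContinuousLinearMap.comp_apply,
        ContinuousLinearMap.inr_apply]
    have e1 : ((1 : ℝ), (ω : E3)) = (1, 0) + (0, (ω : E3)) := by simp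
    simp only [hFdef, hg, sub_self, ← hinit₀, ← hinit₁, dt_eq φ hφ, e1, map_add]
    ring
  unfold sphereIntegral
  rw [hFT, hEq, hF0]
  field_simp

end
end

section
/- (Kirchhoff–Sobolev representation formula on the Minkowski backward null cone for a coupled system of wave equations with first-order terms; Minkowski scalar instance of the paper's main theorem.) Let n ≥ 1, let Φ^{(1)},…,Φ^{(n)}, Ψ^{(1)},…,Ψ^{(n)} ∈ C^∞(ℝ × ℝ³), and for 1 ≤ m,c ≤ n let P^{(mc)} = (P^{(mc)}₀, P⃗^{(mc)}) be smooth 1-forms on ℝ × ℝ³ such that for each m: −∂_t²Φ^{(m)} + ΔΦ^{(m)} + Σ_{c=1}^n [ −P^{(mc)}₀ ∂_tΦ^{(c)} + ⟨P⃗^{(mc)}, ∇_xΦ^{(c)}⟩ ] = Ψ^{(m)} on ℝ × ℝ³. Fix p = (t₀,x₀), v₀ > 0, and real numbers J^{(1)},…,J^{(n)}. Suppose B^{(1)},…,B^{(n)} : [0,v₀] × S² → ℝ are smooth and satisfy the coupled transport system ∂_v B^{(m)}(v,ω) = (1/2) Σ_{c=1}^n P^{(cm)}(L)(γ(v,ω))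 B^{(c)}(v,ω) with B^{(m)}(0,ω) = J^{(m)}, and set A^{(m)}(v,ω) = B^{(m)}(v,ω)/v. Define ν^{(cm)}(v,ω) = −div̸P^{(cm)} + (1/2) ∂_v[ P^{(cm)}(L̄)(γ(v,ω)) ] + (1/(2v)) P^{(cm)}(L̄) − (1/(2v)) P^{(cm)}(L) + (1/4) Σ_{d=1}^n P^{(cd)}(L)·P^{(dm)}(L̄), evaluated at γ(v,ω). Then: 4π Σ_{m=1}^n J^{(m)} Φ^{(m)}(t₀,x₀) = − Σ_m ∫_N A^{(m)} Ψ^{(m)} − Σ_m ∫_N ⟨∇̸A^{(m)}, ∇̸Φ^{(m)}⟩ − Σ_{m,c} ∫_N ⟨P^{(cm)}_tan, ∇̸A^{(c)}⟩ Φ^{(m)} + Σ_{m,c} ∫_N ν^{(cm)} A^{(c)} Φ^{(m)} + Σ_m v₀ ∫_{S²} B^{(m)}(v₀,ω) [ (1/v₀) Φ^{(m)} − L̄Φ^{(m)} ](γ(v₀,ω)) dσ(ω) − (1/2) Σ_{m,c} v₀ ∫_{S²} P^{(cm)}(L̄)(γ(v₀,ω)) B^{(c)}(v₀,ω) Φ^{(m)}(γ(v₀,ω))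 dσ(ω). -/
open MeasureTheory Metric Real
open scoped RealInnerProductSpace

noncomputable section

/-- Spatial gradient `∇_x φ`. -/
def gradx (φ : ℝ × E3 → ℝ) (q : ℝ × E3) : E3 := gradient (fun y => φ (q.1, y)) q.2

/-- The parametrization `γ(v,ω) = (t₀ − v, x₀ + vω)` of the past null cone of `p = (t₀,x₀)`. -/
def nullGen (p : ℝ × E3) (v : ℝ) (ω : E3) : ℝ × E3 := (p.1 - v, p.2 + v • ω)

/-- `P(L) = −P₀ + ⟨ω, P⃗⟩` at the spacetime point `q`, in the null direction attached to `ω`. -/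
def PL (P : ℝ × E3 → ℝ × E3) (q : ℝ × E3) (ω : E3) : ℝ := -(P q).1 + ⟪ω, (P q).2⟫

/-- `P(L̄) = −P₀ − ⟨ω, P⃗⟩`. -/
def PLbar (P : ℝ × E3 → ℝ × E3) (q : ℝ × E3) (ω : E3) : ℝ := -(P q).1 - ⟪ω, (P q).2⟫

/-- The sphere-tangential part `P_tan = P⃗ − ⟨ω,P⃗⟩ω`. -/
def Ptan (P : ℝ × E3 → ℝ × E3) (q : ℝ × E3) (ω : E3) : E3 :=
  (P q).2 - ⟪ω, (P q).2⟫ • ω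

/-- Tangential divergence of `P` on the sphere of radius `v`:
`div̸P = Σ_{i,j} (δ_{ij} − ω_iω_j) ∂_j P⃗_i − (2/v)⟨ω, P⃗⟩` (spatial partials at `q`). -/
def slashDivP (P : ℝ × E3 → ℝ × E3) (q : ℝ × E3) (ω : E3) (v : ℝ) : ℝ :=
  (∑ i : Fin 3, ∑ j : Fin 3,
      ((if i = j then (1:ℝ) else 0) - ω i * ω j) *
        fderiv ℝ (fun y => (P (q.1, y)).2 i) q.2 (EuclideanSpace.single j (1:ℝ)))
    - (2 / v) * ⟪ω, (P q).2⟫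

/-- Tangential gradient of a function `h(v,ω)` on the cone: `(1/v)` times the Euclidean
gradient at `ω` of the `0`-homogeneous extension `x ↦ h(v, x/|x|)`. -/
def slashGradCone (h : ℝ → E3 → ℝ) (v : ℝ) (ω : E3) : E3 :=
  (1/v) • gradient (fun x => h v (‖x‖⁻¹ • x)) ω

/-- Tangential gradient `∇̸u = ∇_xu − (ω·∇_xu)ω` of a spacetime function at a cone point. -/
def slashGradSpace (u : ℝ × E3 → ℝ) (q : ℝ × E3) (ω : E3) : E3 :=
  gradx u q - ⟪ω, gradx u q⟫ • ω

/-- The conjugate null derivative `L̄u = −∂_tu − ω·∇_xu`. -/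
def Lbar (u : ℝ × E3 → ℝ) (q : ℝ × E3) (ω : E3) : ℝ := -dt u q - ⟪ω, gradx u q⟫

/-- Null cone integral `∫_N f = ∫₀^{v₀} ∫_{S²} v² f(v,ω) dσ(ω) dv`. -/
def coneInt (v₀ : ℝ) (f : ℝ → E3 → ℝ) : ℝ :=
  ∫ v in (0:ℝ)..v₀, ∫ ω : sphere (0 : E3) 1, v ^ 2 * f v (ω : E3) ∂sphMeasure

/-- The error coefficients `ν^{(cm)}` of the coupled system:
`ν^{(cm)} = −div̸P^{(cm)} + (1/2) ∂_v[P^{(cm)}(L̄)∘γ] + (1/(2v)) P^{(cm)}(L̄)`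
`− (1/(2v)) P^{(cm)}(L) + (1/4) Σ_d P^{(cd)}(L)·P^{(dm)}(L̄)`, evaluated at `γ(v,ω)`. -/
def nuSys {n : ℕ} (P : Fin n → Fin n → ℝ × E3 → ℝ × E3) (c m : Fin n)
    (p : ℝ × E3) (v : ℝ) (ω : E3) : ℝ :=
  -slashDivP (P c m) (nullGen p v ω) ω v
    + (1/2) * deriv (fun w => PLbar (P c m) (nullGen p w ω) ω) v
    + (1/(2*v)) * PLbar (P c m) (nullGen p v ω) ω
    - (1/(2*v)) * PL (P c m) (nullGen p v ω) ω
    + (1/4) * ∑ d : Fin n,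
        PL (P c d) (nullGen p v ω) ω * PLbar (P d m) (nullGen p v ω) ω


lemma ks_integrable_volumeIoiPow (a : ℝ → ℝ) (ha : Continuous a) (hc : HasCompactSupport a) :
    Integrable (fun r : Set.Ioi (0:ℝ) => a r) (Measure.volumeIoiPow 2) := by
  have h1 : Integrable (fun r : ℝ => r ^ 2 * a r) :=
    (by fun_prop : Continuous (fun r : ℝ => r ^ 2 * a r)).integrable_of_hasCompactSupport
      hc.mul_left
  rw [Measure.volumeIoiPow, integrable_withDensity_iff_integrable_smul']
  · have h2 := (h1.integrableOn (s := Set.Ioi 0))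
    rw [integrableOn_iff_comap_subtypeVal measurableSet_Ioi] at h2
    refine h2.congr (.of_forall ?_)
    rintro ⟨x, hx : 0 < x⟩
    simp (disch := positivity) [ENNReal.toReal_ofReal]
  · fun_prop
  · simp

lemma ks_integral_volumeIoiPow (a : ℝ → ℝ) :
    ∫ r : Set.Ioi (0:ℝ), a r ∂(Measure.volumeIoiPow 2) = ∫ r in Set.Ioi (0:ℝ), r ^ 2 * a r := by
  simp only [Measure.volumeIoiPow, ENNReal.ofReal]
  rw [integral_withDensity_eq_integral_smul,
    integral_subtype_comap measurableSet_Ioi fun r ↦ Real.toNNReal (r ^ 2) • a r,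
    setIntegral_congr_fun measurableSet_Ioi fun x hx ↦ ?_]
  · rw [NNReal.smul_def, Real.coe_toNNReal _ (pow_nonneg hx.out.le _)]; rfl
  · exact (measurable_subtype_coe.pow_const _).real_toNNReal

lemma ks_polar (f : E3 → ℝ) : ∫ x, f x =
    ∫ z : sphere (0:E3) 1 × Set.Ioi (0:ℝ), f ((z.2 : ℝ) • (z.1 : E3))
      ∂(sphMeasure.prod (Measure.volumeIoiPow 2)) := by
  have h0 : ∫ x, f x = ∫ x : ({(0:E3)}ᶜ : Set E3), f x.1 ∂((volume : Measure E3).comap (↑)) := by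
    rw [integral_subtype_comap (measurableSet_singleton _).compl f, restrict_compl_singleton]
  rw [h0]
  have h := (volume : Measure E3).measurePreserving_homeomorphUnitSphereProd.integral_comp
        (Homeomorph.measurableEmbedding _) (fun z => f ((z.2 : ℝ) • (z.1 : E3)))
  have hd : Module.finrank ℝ E3 - 1 = 2 := by simp [E3]
  rw [hd] at h
  rw [sphMeasure, ← h]
  refine integral_congr_ae (.of_forall fun x => ?_)
  have hx : (x : E3) ≠ 0 := x.2
  simp [hx]

instance : IsFiniteMeasure sphMeasure := by unfold sphMeasure; infer_instance

lemma ks_integrable_sphere (f : E3 → ℝ) (hf : Continuous f) :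
    Integrable (fun ω : sphere (0:E3) 1 => f ω) sphMeasure :=
  (by fun_prop : Continuous (fun ω : sphere (0:E3) 1 => f ω)).integrable_of_hasCompactSupport
    (HasCompactSupport.of_compactSpace _)

lemma ks_norm_hasFDerivAt (x : E3) (hx : x ≠ 0) :
    HasFDerivAt (fun y : E3 => ‖y‖) (‖x‖⁻¹ • (innerSL ℝ x)) x := by
  have hn : ‖x‖ ≠ 0 := norm_ne_zero_iff.2 hx
  have h1 : HasFDerivAt (fun y : E3 => ‖y‖ ^ 2) (2 • innerSL ℝ x) x :=
    (hasStrictFDerivAt_norm_sq x).hasFDerivAt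
  have h2 := h1.sqrt (pow_ne_zero 2 hn)
  simp only [Real.sqrt_sq (norm_nonneg _)] at h2
  have h3 : (1 / (2 * ‖x‖)) • (2 • innerSL ℝ x) = ‖x‖⁻¹ • innerSL ℝ x := by
    rw [← Nat.cast_smul_eq_nsmul ℝ, smul_smul]
    congr 1
    push_cast
    field_simp
  rw [h3] at h2
  exact h2

lemma ks_normalize_hasFDerivAt (x : E3) (hx : x ≠ 0) :
    ∃ N : E3 →L[ℝ] E3, HasFDerivAt (fun y : E3 => ‖y‖⁻¹ • y) N x ∧
      ∀ e, N e = ‖x‖⁻¹ • (e - ⟪‖x‖⁻¹ • x, e⟫ • (‖x‖⁻¹ • x)) := by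
  have hn : ‖x‖ ≠ 0 := norm_ne_zero_iff.2 hx
  have h1 := (hasDerivAt_inv hn).comp_hasFDerivAt x (ks_norm_hasFDerivAt x hx)
  have h2 := h1.smul (hasFDerivAt_id x)
  refine ⟨_, h2, fun e => ?_⟩
  simp [inner_smul_left, smul_smul, sub_eq_add_neg]
  congr 1
  field_simp

lemma ks_cutoff : ∃ χ : ℝ → ℝ, ContDiff ℝ 1 χ ∧ HasCompactSupport χ ∧ (∀ r ≤ 1, χ r = 0) ∧
    (∀ r, 3 ≤ r → χ r = 0) ∧ 0 < ∫ r in Set.Ioi (0:ℝ), r * χ r := by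
  obtain ⟨χ, hχ⟩ : ∃ χ : ContDiffBump (2:ℝ), χ.rOut = 1 := ⟨⟨1/2, 1, by norm_num, by norm_num⟩, rfl⟩
  have hχ0 : ∀ r : ℝ, r ≤ 1 → χ r = 0 := fun r hr => by
    apply χ.zero_of_le_dist; rw [hχ, Real.dist_eq, abs_of_nonpos] <;> linarith
  have hχs : ContDiff ℝ 1 χ := χ.contDiff
  have hχc : Continuous χ := hχs.continuous
  refine ⟨χ, hχs, χ.hasCompactSupport, hχ0, ?_, ?_⟩
  · intro r hr
    apply χ.zero_of_le_dist
    rw [hχ, Real.dist_eq, abs_of_nonneg] <;> linarith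
  · rw [setIntegral_eq_integral_of_forall_compl_eq_zero]
    · apply Continuous.integral_pos_of_hasCompactSupport_nonneg_nonzero (x := 2)
      · fun_prop
      · exact χ.hasCompactSupport.mul_left
      · intro r
        by_cases hr : r ≤ 1
        · simp [hχ0 r hr]
        · exact mul_nonneg (by linarith) χ.nonneg
      · have := χ.one_of_mem_closedBall (x := 2) (by simp [χ.rIn_pos.le])
        simp [this]
    · intro r hr
      rw [hχ0 r (by simp at hr; linarith), mul_zero]

lemma ks_cutoff_deriv (χ : ℝ → ℝ) (hχs : ContDiff ℝ 1 χ) (hχcs : HasCompactSupport χ) :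
    ∫ r in Set.Ioi (0:ℝ), r ^ 2 * deriv χ r = - (2 * ∫ r in Set.Ioi (0:ℝ), r * χ r) := by
  have hχd : Continuous (deriv χ) := hχs.continuous_deriv le_rfl
  have hχc : Continuous χ := hχs.continuous
  have hcc : HasCompactSupport (fun r : ℝ => r ^ 2 * χ r) := hχcs.mul_left
  have h := HasCompactSupport.integral_Ioi_deriv_eq (f := fun r : ℝ => r ^ 2 * χ r) (by fun_prop)
    hcc 0
  have hd : ∀ r, deriv (fun r : ℝ => r ^ 2 * χ r) r = 2 * (r * χ r) + r ^ 2 * deriv χ r := by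
    intro r
    have := ((hasDerivAt_pow 2 r).fun_mul ((hχs.differentiable (by simp)) r).hasDerivAt)
    rw [this.deriv]; simp; ring
  simp only [hd] at h
  rw [integral_add, integral_const_mul] at h
  · simp at h; linarith
  · exact ((by fun_prop : Continuous fun r : ℝ => 2 * (r * χ r)).integrable_of_hasCompactSupport
      (hχcs.mul_left.mul_left)).integrableOn
  · exact ((by fun_prop : Continuous fun r : ℝ => r^2 * deriv χ r).integrable_of_hasCompactSupport
      (hχcs.deriv.mul_left)).integrableOn

lemma ks_tangential (g : E3 → ℝ) (hg : ContDiff ℝ 1 g) (e : E3) :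
    ∫ ω : sphere (0:E3) 1, (fderiv ℝ g ω e - ⟪(ω:E3), e⟫ * fderiv ℝ g ω ω
      - 2 * (⟪(ω:E3), e⟫ * g ω)) ∂sphMeasure = 0 := by
  obtain ⟨χ, hχs, hχcs, hχ0, hχ3, hIpos⟩ := ks_cutoff
  have hχd : Continuous (deriv χ) := hχs.continuous_deriv le_rfl
  have hχc : Continuous χ := hχs.continuous
  set I : ℝ := ∫ r in Set.Ioi (0:ℝ), r * χ r with hI
  have hI2 : ∫ r in Set.Ioi (0:ℝ), r ^ 2 * deriv χ r = - (2 * I) := ks_cutoff_deriv χ hχs hχcs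
  set h : E3 → ℝ := fun x => χ ‖x‖ * g (‖x‖⁻¹ • x) with hh
  have hsm : ContDiff ℝ 1 h := by
    rw [contDiff_iff_contDiffAt]
    intro x
    by_cases hx : x = 0
    · have : h =ᶠ[nhds x] fun _ => 0 := by
        have : ball (0:E3) 1 ∈ nhds x := by rw [hx]; exact ball_mem_nhds _ one_pos
        filter_upwards [this] with y hy
        simp only [hh]
        rw [hχ0 _ (by simpa using (mem_ball_zero_iff.1 hy).le), zero_mul]
      exact contDiffAt_const.congr_of_eventuallyEq this
    · have hn : ContDiffAt ℝ 1 (fun y : E3 => ‖y‖) x := contDiffAt_norm ℝ hx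
      refine (hχs.contDiffAt.comp x hn).mul (hg.contDiffAt.comp x ?_)
      exact (hn.inv (norm_ne_zero_iff.2 hx)).smul contDiffAt_id
  have hcs : HasCompactSupport h := by
    refine HasCompactSupport.of_support_subset_isCompact (isCompact_closedBall (0:E3) 3) ?_
    intro x hx
    by_contra hc
    apply hx
    simp at hc
    simp only [hh]
    rw [hχ3 _ hc.le, zero_mul]
  have hint : ∫ x, fderiv ℝ h x e = 0 := by
    have := integral_mul_fderiv_eq_neg_fderiv_mul_of_integrable (μ := (volume : Measure E3))
      (f := fun _ => (1:ℝ)) (g := h) (v := e) (by simp)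
      (by
        simp only [one_mul]
        apply Continuous.integrable_of_hasCompactSupport
        · exact (hsm.continuous_fderiv (by simp)).clm_apply continuous_const
        · exact hcs.fderiv_apply ℝ e)
      (by simpa using hsm.continuous.integrable_of_hasCompactSupport hcs)
      (by simp) (fun x _ => (hsm.differentiable (by simp)) x)
    simpa using this
  rw [ks_polar] at hint
  have hform : ∀ z : sphere (0:E3) 1 × Set.Ioi (0:ℝ), fderiv ℝ h ((z.2 : ℝ) • (z.1 : E3)) e =
      (⟪(z.1:E3), e⟫ * g z.1) * deriv χ z.2 +
        (fderiv ℝ g z.1 e - ⟪(z.1:E3), e⟫ * fderiv ℝ g z.1 z.1) * ((z.2:ℝ)⁻¹ * χ z.2) := by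
    rintro ⟨⟨w, hw⟩, ⟨r, hr : 0 < r⟩⟩
    have hw1 : ‖w‖ = 1 := by simpa using hw
    have hx : r • w ≠ 0 := smul_ne_zero hr.ne' (by rintro rfl; simp at hw1)
    have hnr : ‖r • w‖ = r := by simp [norm_smul, hw1, abs_of_pos hr]
    have hnw : ‖r • w‖⁻¹ • (r • w) = w := by rw [hnr, smul_smul, inv_mul_cancel₀ hr.ne', one_smul]
    obtain ⟨N, hN, hNe⟩ := ks_normalize_hasFDerivAt _ hx
    have h1 : HasDerivAt χ (deriv χ ‖r • w‖) ‖r • w‖ :=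
      ((hχs.differentiable (by simp)) _).hasDerivAt
    have h2 : HasFDerivAt g (fderiv ℝ g (‖r • w‖⁻¹ • (r • w))) (‖r • w‖⁻¹ • (r • w)) :=
      ((hg.differentiable (by simp)) _).hasFDerivAt
    have h3 := (h1.comp_hasFDerivAt _ (ks_norm_hasFDerivAt _ hx)).mul (HasFDerivAt.comp (g := g) (f := fun y : E3 => ‖y‖⁻¹ • y) (r • w) h2 hN)
    have h4 : fderiv ℝ h (r • w) = _ := HasFDerivAt.fderiv h3
    rw [h4]
    simp only [Function.comp, hnw, _root_.add_apply, _root_.smul_apply,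
      ContinuousLinearMap.comp_apply, hNe]
    simp [hnr]
    field_simp
    ring
  simp only [hform] at hint
  have hgc : Continuous g := hg.continuous
  have hgd : Continuous (fderiv ℝ g) := hg.continuous_fderiv (by simp)
  have i1 := ks_integrable_sphere (fun w => ⟪w, e⟫ * g w) (by fun_prop)
  have i2 := ks_integrable_sphere (fun w => fderiv ℝ g w e - ⟪w, e⟫ * fderiv ℝ g w w) (by fun_prop)
  have hinvc : Continuous (fun r : ℝ => r⁻¹ * χ r) := by
    rw [continuous_iff_continuousAt]
    intro x
    by_cases hx : x = 0
    · have : (fun r : ℝ => r⁻¹ * χ r) =ᶠ[nhds x] fun _ => 0 := by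
        filter_upwards [Iio_mem_nhds (show x < 1 by simp [hx])] with y hy
        rw [hχ0 y (le_of_lt hy), mul_zero]
      exact continuousAt_const.congr this.symm
    · exact (continuousAt_inv₀ hx).mul hχc.continuousAt
  rw [integral_add, integral_prod_mul (fun w : sphere (0:E3) 1 => ⟪(w:E3), e⟫ * g w)
      (fun r : Set.Ioi (0:ℝ) => deriv χ r),
    integral_prod_mul (fun w : sphere (0:E3) 1 => fderiv ℝ g w e - ⟪(w:E3), e⟫ * fderiv ℝ g w w)
      (fun r : Set.Ioi (0:ℝ) => (r:ℝ)⁻¹ * χ r), ks_integral_volumeIoiPow (deriv χ),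
      ks_integral_volumeIoiPow (fun r => r⁻¹ * χ r), hI2,
      show ∫ r in Set.Ioi (0:ℝ), r ^ 2 * (r⁻¹ * χ r) = I from
        setIntegral_congr_fun measurableSet_Ioi (fun r (hr : 0 < r) => by
          field_simp)] at hint
  · rw [integral_sub i2 (i1.const_mul 2), integral_const_mul]
    have : I * (∫ (a : sphere (0:E3) 1), (fderiv ℝ g ↑a) e - ⟪↑a, e⟫ * (fderiv ℝ g ↑a) ↑a ∂sphMeasure -
      2 * ∫ (a : sphere (0:E3) 1), ⟪↑a, e⟫ * g ↑a ∂sphMeasure) = 0 := by linarith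
    exact (mul_eq_zero.1 this).resolve_left hIpos.ne'
  · exact i1.mul_prod (ks_integrable_volumeIoiPow _ hχd hχcs.deriv)
  · exact i2.mul_prod (ks_integrable_volumeIoiPow _ hinvc hχcs.mul_left)


/-- Integration over the cone of a function of `(v, ω)`, without weight. -/
def ksS (v₀ : ℝ) (f : ℝ × E3 → ℝ) : ℝ :=
  ∫ v in (0:ℝ)..v₀, ∫ ω : sphere (0 : E3) 1, f (v, (ω : E3)) ∂sphMeasure

lemma ks_integrable_prod (v₀ : ℝ) (f : ℝ × E3 → ℝ) (hf : Continuous f) :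
    Integrable (fun z : ℝ × sphere (0:E3) 1 => f (z.1, (z.2 : E3)))
      ((volume.restrict (Set.Ioc 0 v₀)).prod sphMeasure) := by
  have h : IntegrableOn (fun z : ℝ × sphere (0:E3) 1 => f (z.1, (z.2 : E3)))
      (Set.Icc 0 v₀ ×ˢ Set.univ) (volume.prod sphMeasure) :=
    ContinuousOn.integrableOn_compact (isCompact_Icc.prod isCompact_univ) (by fun_prop)
  have h2 := h.mono_set (Set.prod_mono (Set.Ioc_subset_Icc_self) (Set.Subset.refl _))
  rw [IntegrableOn, ← Measure.prod_restrict, Measure.restrict_univ] at h2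
  exact h2

lemma ksS_eq (v₀ : ℝ) (hv : 0 < v₀) (f : ℝ × E3 → ℝ) (hf : Continuous f) :
    ksS v₀ f = ∫ z : ℝ × sphere (0:E3) 1, f (z.1, (z.2 : E3))
      ∂((volume.restrict (Set.Ioc 0 v₀)).prod sphMeasure) := by
  rw [ksS, intervalIntegral.integral_of_le hv.le, integral_prod _ (ks_integrable_prod v₀ f hf)]

lemma ksS_add (v₀ : ℝ) (hv : 0 < v₀) (f g : ℝ × E3 → ℝ) (hf : Continuous f) (hg : Continuous g) :
    ksS v₀ (fun q => f q + g q) = ksS v₀ f + ksS v₀ g := by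
  rw [ksS_eq v₀ hv _ hf, ksS_eq v₀ hv _ hg, ksS_eq v₀ hv (fun q => f q + g q) (hf.add hg),
    integral_add (ks_integrable_prod v₀ f hf) (ks_integrable_prod v₀ g hg)]

lemma ksS_sub (v₀ : ℝ) (hv : 0 < v₀) (f g : ℝ × E3 → ℝ) (hf : Continuous f) (hg : Continuous g) :
    ksS v₀ (fun q => f q - g q) = ksS v₀ f - ksS v₀ g := by
  rw [ksS_eq v₀ hv _ hf, ksS_eq v₀ hv _ hg, ksS_eq v₀ hv (fun q => f q - g q) (hf.sub hg),
    integral_sub (ks_integrable_prod v₀ f hf) (ks_integrable_prod v₀ g hg)]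

lemma ksS_sum (v₀ : ℝ) (hv : 0 < v₀) {ι : Type*} (s : Finset ι) (f : ι → ℝ × E3 → ℝ)
    (hf : ∀ i, Continuous (f i)) :
    ksS v₀ (fun q => ∑ i ∈ s, f i q) = ∑ i ∈ s, ksS v₀ (f i) := by
  rw [ksS_eq v₀ hv _ (by fun_prop), integral_finsetSum _ fun i _ => ks_integrable_prod v₀ _ (hf i)]
  exact Finset.sum_congr rfl fun i _ => (ksS_eq v₀ hv _ (hf i)).symm

lemma ksS_congr (v₀ : ℝ) (hv : 0 < v₀) (f g : ℝ × E3 → ℝ)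
    (h : ∀ v ∈ Set.Icc 0 v₀, ∀ ω ∈ sphere (0:E3) 1, f (v, ω) = g (v, ω)) :
    ksS v₀ f = ksS v₀ g := by
  refine intervalIntegral.integral_congr fun v hv' => ?_
  rw [Set.uIcc_of_le hv.le] at hv'
  exact integral_congr_ae (.of_forall fun ω => h v hv' ω ω.2)

lemma ks_coneInt (v₀ : ℝ) (hv : 0 < v₀) (f : ℝ → E3 → ℝ) (g : ℝ × E3 → ℝ)
    (h : ∀ v, 0 < v → ∀ ω : E3, ‖ω‖ = 1 → v ^ 2 * f v ω = g (v, ω)) :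
    coneInt v₀ f = ksS v₀ g := by
  rw [coneInt, ksS, intervalIntegral.integral_of_le hv.le, intervalIntegral.integral_of_le hv.le]
  refine setIntegral_congr_fun measurableSet_Ioc fun v hv' => ?_
  exact integral_congr_ae (.of_forall fun ω => h v hv'.1 ω (by simp))

lemma ks_total (f : ℝ) : ∫ _ω : sphere (0:E3) 1, f ∂sphMeasure = 4 * π * f := by
  rw [integral_const, sphMeasure, Measure.toSphere_real_apply_univ, measureReal_def,
    EuclideanSpace.volume_ball_fin_three]
  have : 0 ≤ π * 4 / 3 := by positivity
  simp only [ENNReal.toReal_mul, ENNReal.toReal_pow, ENNReal.toReal_ofReal this, finrank_euclideanSpace, Fintype.card_fin, smul_eq_mul]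
  simp
  ring_nf
  simp

lemma ks_general (v₀ : ℝ) (hv : 0 < v₀) (F X T : ℝ × E3 → ℝ)
    (hF : Continuous F) (hX : Continuous X) (hT : Continuous T)
    (hd : ∀ v ω, HasDerivAt (fun w => F (w, ω)) (X (v, ω)) v)
    (hT0 : ∀ v, ∫ ω : sphere (0:E3) 1, T (v, (ω:E3)) ∂sphMeasure = 0) :
    ksS v₀ (fun q => X q + T q) = (∫ ω : sphere (0:E3) 1, F (v₀, (ω:E3)) ∂sphMeasure)
      - ∫ ω : sphere (0:E3) 1, F (0, (ω:E3)) ∂sphMeasure := by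
  rw [ksS_add v₀ hv X T hX hT]
  have h1 : ksS v₀ T = 0 := by simp [ksS, hT0]
  have h2 : ksS v₀ X = ∫ ω : sphere (0:E3) 1, (F (v₀, (ω:E3)) - F (0, (ω:E3))) ∂sphMeasure := by
    rw [ksS, intervalIntegral_integral_swap]
    · refine integral_congr_ae (.of_forall fun ω => ?_)
      exact intervalIntegral.integral_eq_sub_of_hasDerivAt (fun v _ => hd v ω)
        ((by fun_prop : Continuous fun v => X (v, (ω:E3))).intervalIntegrable _ _)
    · rw [Set.uIoc_of_le hv.le]
      exact ks_integrable_prod v₀ X hX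
  rw [h1, h2, add_zero, integral_sub]
  · exact ks_integrable_sphere (fun w => F (v₀, w)) (by fun_prop)
  · exact ks_integrable_sphere (fun w => F (0, w)) (by fun_prop)

lemma ks_tangential_div (G : Fin 3 → E3 → ℝ) (hG : ∀ j, ContDiff ℝ 1 (G j)) :
    ∫ ω : sphere (0:E3) 1, (∑ j, (fderiv ℝ (G j) ω (EuclideanSpace.single j 1)
      - (ω:E3) j * fderiv ℝ (G j) ω ω - 2 * ((ω:E3) j * G j ω))) ∂sphMeasure = 0 := by
  have hd : ∀ j, Continuous (fderiv ℝ (G j)) := fun j => (hG j).continuous_fderiv (by simp)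
  have hc : ∀ j, Continuous (G j) := fun j => (hG j).continuous
  rw [integral_finsetSum]
  · refine Finset.sum_eq_zero fun j _ => ?_
    have := ks_tangential (G j) (hG j) (EuclideanSpace.single j 1)
    simpa [EuclideanSpace.inner_single_right] using this
  · intro j _
    have := hd j
    have := hc j
    exact ks_integrable_sphere (fun w => fderiv ℝ (G j) w (EuclideanSpace.single j 1)
      - w j * fderiv ℝ (G j) w w - 2 * (w j * G j w)) (by fun_prop)


lemma ks_hd_congr {f : ℝ → ℝ} {f' g' x : ℝ} (h : HasDerivAt f f' x) (e : g' = f') :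
    HasDerivAt f g' x := e ▸ h

lemma ks_nullGen_v (p : ℝ × E3) (v : ℝ) (ω : E3) :
    HasDerivAt (fun w => nullGen p w ω) (-1, ω) v := by
  unfold nullGen
  refine HasDerivAt.prodMk ?_ ?_
  · simpa using (hasDerivAt_id v).const_sub p.1
  · simpa using ((hasDerivAt_id v).smul_const ω).const_add p.2

lemma ks_nullGen_ω (p : ℝ × E3) (v : ℝ) (ω : E3) :
    HasFDerivAt (fun y => nullGen p v y)
      ((0 : E3 →L[ℝ] ℝ).prod (v • ContinuousLinearMap.id ℝ E3)) ω := by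
  unfold nullGen
  refine HasFDerivAt.prodMk (hasFDerivAt_const _ _) ?_
  exact ((hasFDerivAt_id ω).const_smul v).const_add p.2

lemma ks_contDiff_nullGen (p : ℝ × E3) {n : WithTop ℕ∞} :
    ContDiff ℝ n (fun q : ℝ × E3 => nullGen p q.1 q.2) := by
  unfold nullGen; fun_prop

lemma ks_continuous_nullGen (p : ℝ × E3) :
    Continuous (fun q : ℝ × E3 => nullGen p q.1 q.2) :=
  (ks_contDiff_nullGen p (n := 0)).continuous

lemma ks_comp_v {W : Type*} [NormedAddCommGroup W] [NormedSpace ℝ W] (u : ℝ × E3 → W)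
    (hu : Differentiable ℝ u) (p : ℝ × E3) (v : ℝ) (ω : E3) :
    HasDerivAt (fun w => u (nullGen p w ω)) (fderiv ℝ u (nullGen p v ω) (-1, ω)) v :=
  (hu _).hasFDerivAt.comp_hasDerivAt v (ks_nullGen_v p v ω)

lemma ks_comp_ω {W : Type*} [NormedAddCommGroup W] [NormedSpace ℝ W] (u : ℝ × E3 → W)
    (hu : Differentiable ℝ u) (p : ℝ × E3) (v : ℝ) (ω : E3) :
    HasFDerivAt (fun y => u (nullGen p v y)) ((fderiv ℝ u (nullGen p v ω)).comp
      ((0 : E3 →L[ℝ] ℝ).prod (v • ContinuousLinearMap.id ℝ E3))) ω :=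
  (hu _).hasFDerivAt.comp ω (ks_nullGen_ω p v ω)

lemma ks_b_v (b : ℝ × E3 → ℝ) (hb : Differentiable ℝ b) (v : ℝ) (ω : E3) :
    HasDerivAt (fun w => b (w, ω)) (fderiv ℝ b (v, ω) (1, 0)) v :=
  (hb _).hasFDerivAt.comp_hasDerivAt v ((hasDerivAt_id v).prodMk (hasDerivAt_const v ω))

lemma ks_b_ω (b : ℝ × E3 → ℝ) (hb : Differentiable ℝ b) (v : ℝ) (ω : E3) :
    HasFDerivAt (fun y => b (v, y)) ((fderiv ℝ b (v, ω)).comp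
      ((0 : E3 →L[ℝ] ℝ).prod (ContinuousLinearMap.id ℝ E3))) ω :=
  (hb _).hasFDerivAt.comp ω ((hasFDerivAt_const v ω).prodMk (hasFDerivAt_id ω))

/-- The angular pairing of the gradients of `b` and `u`. -/
def ksK2 (p : ℝ × E3) (b u : ℝ × E3 → ℝ) (q : ℝ × E3) : ℝ :=
  (∑ j : Fin 3, fderiv ℝ b q (0, EuclideanSpace.single j 1) *
    fderiv ℝ u (nullGen p q.1 q.2) (0, EuclideanSpace.single j 1))
  - fderiv ℝ b q (0, q.2) * fderiv ℝ u (nullGen p q.1 q.2) (0, q.2)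

def ksF1 (p : ℝ × E3) (b u : ℝ × E3 → ℝ) (q : ℝ × E3) : ℝ :=
  b q * u (nullGen p q.1 q.2) - q.1 * (b q * fderiv ℝ u (nullGen p q.1 q.2) (-1, -q.2))

def ksBox (u : ℝ × E3 → ℝ) (q : ℝ × E3) : ℝ :=
  - fderiv ℝ (fderiv ℝ u) q (1, 0) (1, 0) + ∑ j : Fin 3, fderiv ℝ (fderiv ℝ u) q
    (0, EuclideanSpace.single j 1) (0, EuclideanSpace.single j 1)

def ksZ1 (p : ℝ × E3) (b u : ℝ × E3 → ℝ) (q : ℝ × E3) : ℝ :=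
  fderiv ℝ b q (1, 0) * u (nullGen p q.1 q.2)
  - q.1 * (fderiv ℝ b q (1, 0) * fderiv ℝ u (nullGen p q.1 q.2) (-1, -q.2))
  + q.1 * b q * ksBox u (nullGen p q.1 q.2)

def ksX1 (p : ℝ × E3) (b u : ℝ × E3 → ℝ) (q : ℝ × E3) : ℝ :=
  fderiv ℝ b q (1, 0) * u (nullGen p q.1 q.2)
  + b q * fderiv ℝ u (nullGen p q.1 q.2) (-1, q.2)
  - b q * fderiv ℝ u (nullGen p q.1 q.2) (-1, -q.2)
  - q.1 * (fderiv ℝ b q (1, 0) * fderiv ℝ u (nullGen p q.1 q.2) (-1, -q.2))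
  - q.1 * b q * fderiv ℝ (fderiv ℝ u) (nullGen p q.1 q.2) (-1, q.2) (-1, -q.2)

def ksT1 (p : ℝ × E3) (b u : ℝ × E3 → ℝ) (q : ℝ × E3) : ℝ :=
  ∑ j : Fin 3, (
    (fderiv ℝ b q (0, EuclideanSpace.single j 1) * fderiv ℝ u (nullGen p q.1 q.2) (0, EuclideanSpace.single j 1)
      + b q * (q.1 * fderiv ℝ (fderiv ℝ u) (nullGen p q.1 q.2)
        (0, EuclideanSpace.single j 1) (0, EuclideanSpace.single j 1)))
    - q.2 j * (fderiv ℝ b q (0, q.2) * fderiv ℝ u (nullGen p q.1 q.2) (0, EuclideanSpace.single j 1)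
      + b q * (q.1 * fderiv ℝ (fderiv ℝ u) (nullGen p q.1 q.2)
        (0, q.2) (0, EuclideanSpace.single j 1)))
    - 2 * (q.2 j * (b q * fderiv ℝ u (nullGen p q.1 q.2) (0, EuclideanSpace.single j 1))))

lemma ks_sum_coord (A : ℝ × E3 →L[ℝ] ℝ) (ω : E3) :
    A (0, ω) = ∑ j : Fin 3, ω j * A (0, EuclideanSpace.single j 1) := by
  have h : ((0:ℝ), ω) = ∑ j : Fin 3, ω j • ((0:ℝ), (EuclideanSpace.single j (1:ℝ) : E3)) := by
    refine Prod.ext ?_ ?_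
    · simp [Fin.sum_univ_three]
    · rw [Prod.snd_sum]
      ext i
      fin_cases i <;> simp [Fin.sum_univ_three]
  conv_lhs => rw [h]
  simp only [map_sum, map_smul, smul_eq_mul]

lemma ks_split (A : ℝ × E3 →L[ℝ] ℝ) (a : ℝ) (ω : E3) :
    A (a, ω) = a * A (1, 0) + A (0, ω) := by
  have h : (a, ω) = a • ((1:ℝ), (0:E3)) + (0, ω) := by simp
  conv_lhs => rw [h]
  rw [map_add, map_smul, smul_eq_mul]

lemma ks_neg (A : ℝ × E3 →L[ℝ] ℝ) (ω : E3) : A (0, -ω) = - A (0, ω) := by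
  have h : ((0:ℝ), -ω) = - (0, ω) := by simp
  rw [h, map_neg]

lemma ks_alg1 (p : ℝ × E3) (b u : ℝ × E3 → ℝ) (q : ℝ × E3) (hu : ContDiff ℝ (⊤ : ℕ∞) u) :
    ksX1 p b u q + ksT1 p b u q = ksZ1 p b u q + ksK2 p b u q := by
  have hsym : fderiv ℝ (fderiv ℝ u) (nullGen p q.1 q.2) (0, q.2) (1, 0) =
      fderiv ℝ (fderiv ℝ u) (nullGen p q.1 q.2) (1, 0) (0, q.2) :=
    (hu.contDiffAt.isSymmSndFDerivAt (by simp; exact WithTop.coe_le_coe.2 (le_top : (2:ℕ∞) ≤ ⊤))) _ _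
  have hsp : ∀ a ω, fderiv ℝ (fderiv ℝ u) (nullGen p q.1 q.2) (a, ω) =
      a • fderiv ℝ (fderiv ℝ u) (nullGen p q.1 q.2) (1, 0) +
      fderiv ℝ (fderiv ℝ u) (nullGen p q.1 q.2) (0, ω) := by
    intro a ω
    have h : (a, ω) = a • ((1:ℝ), (0:E3)) + (0, ω) := by simp
    conv_lhs => rw [h]
    rw [map_add, map_smul]
  unfold ksX1 ksT1 ksZ1 ksK2 ksBox
  rw [ks_split _ (-1) q.2, ks_split _ (-1) (-q.2), hsp (-1) q.2, ks_neg]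
  simp only [_root_.add_apply, _root_.smul_apply]
  rw [ks_split _ (-1) (-q.2), ks_split _ (-1) (-q.2), ks_neg, ks_neg, hsym]
  have e1 := ks_sum_coord (fderiv ℝ u (nullGen p q.1 q.2)) q.2
  have e2 := ks_sum_coord (fderiv ℝ (fderiv ℝ u) (nullGen p q.1 q.2) (0, q.2)) q.2
  rw [Fin.sum_univ_three] at e1 e2
  simp only [Fin.sum_univ_three, smul_eq_mul]
  linear_combination (2 * b q + fderiv ℝ b q (0, q.2)) * e1 + b q * q.1 * e2

lemma ks_part1 (v₀ : ℝ) (hv : 0 < v₀) (p : ℝ × E3) (b u : ℝ × E3 → ℝ)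
    (hb : ContDiff ℝ (⊤ : ℕ∞) b) (hu : ContDiff ℝ (⊤ : ℕ∞) u) :
    ksS v₀ (fun q => ksZ1 p b u q + ksK2 p b u q) =
      (∫ ω : sphere (0:E3) 1, ksF1 p b u (v₀, (ω:E3)) ∂sphMeasure)
      - ∫ ω : sphere (0:E3) 1, ksF1 p b u (0, (ω:E3)) ∂sphMeasure := by
  have hbd : Differentiable ℝ b := hb.differentiable (by simp)
  have hud : Differentiable ℝ u := hu.differentiable (by simp)
  have hu1 : ContDiff ℝ (⊤ : ℕ∞) (fderiv ℝ u) := hu.fderiv_right (by simp)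
  have hudd : Differentiable ℝ (fderiv ℝ u) := hu1.differentiable (by simp)
  have c1 := hb.continuous
  have c2 := hu.continuous
  have c3 : Continuous (fderiv ℝ b) := hb.continuous_fderiv (by simp)
  have c4 := hu1.continuous
  have c5 : Continuous (fderiv ℝ (fderiv ℝ u)) := hu1.continuous_fderiv (by simp)
  have c6 := ks_continuous_nullGen p
  rw [← ks_general v₀ hv (ksF1 p b u) (ksX1 p b u) (ksT1 p b u)]
  · simp only [ks_alg1 p b u _ hu]
  · unfold ksF1; fun_prop
  · unfold ksX1; fun_prop
  · unfold ksT1; fun_prop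
  · intro v ω
    have h1 := ks_b_v b hbd v ω
    have h2 := ks_comp_v u hud p v ω
    have h3 := (ks_comp_v (fderiv ℝ u) hudd p v ω).clm_apply (hasDerivAt_const v ((-1:ℝ), -ω))
    have h4 := (h1.fun_mul h2).fun_sub ((hasDerivAt_id' v).fun_mul (h1.fun_mul h3))
    unfold ksF1 ksX1
    refine ks_hd_congr h4 ?_
    simp
    ring
  · intro v
    have h := ks_tangential_div (fun j y => b (v, y) *
      fderiv ℝ u (nullGen p v y) (0, EuclideanSpace.single j 1)) (fun j => by
        have := (ks_contDiff_nullGen p (n := 1)).comp (contDiff_prodMk_right v)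
        have := (hu1.of_le (m := 1) (by simp)).comp this
        have h2 := (hb.of_le (m := 1) (by simp)).comp (contDiff_prodMk_right v)
        exact h2.mul (this.clm_apply contDiff_const))
    rw [← h]
    refine integral_congr_ae (.of_forall fun ω => ?_)
    unfold ksT1
    refine Finset.sum_congr rfl fun j _ => ?_
    have hd : ∀ e : E3, fderiv ℝ (fun y => b (v, y) *
      fderiv ℝ u (nullGen p v y) (0, EuclideanSpace.single j 1)) (ω:E3) e =
      fderiv ℝ b (v, (ω:E3)) (0, e) * fderiv ℝ u (nullGen p v ω) (0, EuclideanSpace.single j 1)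
      + b (v, (ω:E3)) * (v * fderiv ℝ (fderiv ℝ u) (nullGen p v ω)
        (0, e) (0, EuclideanSpace.single j 1)) := by
      intro e
      have h1 := ks_b_ω b hbd v ω
      have h3 := (ks_comp_ω (fderiv ℝ u) hudd p v ω).clm_apply
        (hasFDerivAt_const ((0:ℝ), (EuclideanSpace.single j 1 : E3)) (ω:E3))
      rw [(h1.fun_mul h3).fderiv]
      have hs : fderiv ℝ (fderiv ℝ u) (nullGen p v ω) (0, v • e) =
          v • fderiv ℝ (fderiv ℝ u) (nullGen p v ω) (0, e) := by
        rw [← map_smul]; simp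
      simp [hs]
      ring
    rw [hd, hd]


def ksPw (p : ℝ × E3) (R : Fin 3 → ℝ × E3 → ℝ) (q : ℝ × E3) : ℝ :=
  ∑ j : Fin 3, q.2 j * R j (nullGen p q.1 q.2)

def ksPb (p : ℝ × E3) (P0 : ℝ × E3 → ℝ) (R : Fin 3 → ℝ × E3 → ℝ) (q : ℝ × E3) : ℝ :=
  - P0 (nullGen p q.1 q.2) - ksPw p R q

def ksPl (p : ℝ × E3) (P0 : ℝ × E3 → ℝ) (R : Fin 3 → ℝ × E3 → ℝ) (q : ℝ × E3) : ℝ :=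
  - P0 (nullGen p q.1 q.2) + ksPw p R q

def ksPbL (p : ℝ × E3) (P0 : ℝ × E3 → ℝ) (R : Fin 3 → ℝ × E3 → ℝ) (q : ℝ × E3) : ℝ :=
  - fderiv ℝ P0 (nullGen p q.1 q.2) (-1, q.2)
    - ∑ j : Fin 3, q.2 j * fderiv ℝ (R j) (nullGen p q.1 q.2) (-1, q.2)

def ksDiv (p : ℝ × E3) (R : Fin 3 → ℝ × E3 → ℝ) (q : ℝ × E3) : ℝ :=
  q.1 * (∑ i : Fin 3, ∑ j : Fin 3, ((if i = j then (1:ℝ) else 0) - q.2 i * q.2 j) *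
    fderiv ℝ (R i) (nullGen p q.1 q.2) (0, EuclideanSpace.single j 1)) - 2 * ksPw p R q

def ksK3 (p : ℝ × E3) (R : Fin 3 → ℝ × E3 → ℝ) (b u : ℝ × E3 → ℝ) (q : ℝ × E3) : ℝ :=
  ((∑ j : Fin 3, R j (nullGen p q.1 q.2) * fderiv ℝ b q (0, EuclideanSpace.single j 1))
    - ksPw p R q * fderiv ℝ b q (0, q.2)) * u (nullGen p q.1 q.2)

def ksF2 (p : ℝ × E3) (P0 : ℝ × E3 → ℝ) (R : Fin 3 → ℝ × E3 → ℝ) (b u : ℝ × E3 → ℝ)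
    (q : ℝ × E3) : ℝ :=
  -(1/2) * (q.1 * (ksPb p P0 R q * b q * u (nullGen p q.1 q.2)))

def ksX2 (p : ℝ × E3) (P0 : ℝ × E3 → ℝ) (R : Fin 3 → ℝ × E3 → ℝ) (b u : ℝ × E3 → ℝ)
    (q : ℝ × E3) : ℝ :=
  -(1/2) * (ksPb p P0 R q * b q * u (nullGen p q.1 q.2)
    + q.1 * (ksPbL p P0 R q * b q * u (nullGen p q.1 q.2))
    + q.1 * (ksPb p P0 R q * fderiv ℝ b q (1, 0) * u (nullGen p q.1 q.2))
    + q.1 * (ksPb p P0 R q * b q * fderiv ℝ u (nullGen p q.1 q.2) (-1, q.2)))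

def ksT2 (p : ℝ × E3) (R : Fin 3 → ℝ × E3 → ℝ) (b u : ℝ × E3 → ℝ) (q : ℝ × E3) : ℝ :=
  ∑ j : Fin 3, (
    (fderiv ℝ b q (0, EuclideanSpace.single j 1) * R j (nullGen p q.1 q.2) * u (nullGen p q.1 q.2)
      + b q * (q.1 * fderiv ℝ (R j) (nullGen p q.1 q.2) (0, EuclideanSpace.single j 1))
        * u (nullGen p q.1 q.2)
      + b q * R j (nullGen p q.1 q.2) *
        (q.1 * fderiv ℝ u (nullGen p q.1 q.2) (0, EuclideanSpace.single j 1)))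
    - q.2 j * (fderiv ℝ b q (0, q.2) * R j (nullGen p q.1 q.2) * u (nullGen p q.1 q.2)
      + b q * (q.1 * fderiv ℝ (R j) (nullGen p q.1 q.2) (0, q.2)) * u (nullGen p q.1 q.2)
      + b q * R j (nullGen p q.1 q.2) * (q.1 * fderiv ℝ u (nullGen p q.1 q.2) (0, q.2)))
    - 2 * (q.2 j * (b q * R j (nullGen p q.1 q.2) * u (nullGen p q.1 q.2))))

def ksY2 (p : ℝ × E3) (P0 : ℝ × E3 → ℝ) (R : Fin 3 → ℝ × E3 → ℝ) (b u : ℝ × E3 → ℝ)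
    (q : ℝ × E3) : ℝ :=
  ksX2 p P0 R b u q + ksK3 p R b u q + ksDiv p R q * b q * u (nullGen p q.1 q.2)
    + q.1 * b q * ((∑ j : Fin 3, R j (nullGen p q.1 q.2) *
      fderiv ℝ u (nullGen p q.1 q.2) (0, EuclideanSpace.single j 1))
      - ksPw p R q * fderiv ℝ u (nullGen p q.1 q.2) (0, q.2))

lemma ks_alg2 (p : ℝ × E3) (P0 : ℝ × E3 → ℝ) (R : Fin 3 → ℝ × E3 → ℝ) (b u : ℝ × E3 → ℝ)
    (q : ℝ × E3) : ksX2 p P0 R b u q + ksT2 p R b u q = ksY2 p P0 R b u q := by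
  unfold ksY2 ksT2 ksK3 ksDiv ksPw
  have e : ∀ j, fderiv ℝ (R j) (nullGen p q.1 q.2) (0, q.2) = _ := fun j => ks_sum_coord _ _
  simp only [e]
  simp [Fin.sum_univ_three]
  ring

lemma ks_part2 (v₀ : ℝ) (hv : 0 < v₀) (p : ℝ × E3) (P0 : ℝ × E3 → ℝ) (R : Fin 3 → ℝ × E3 → ℝ)
    (b u : ℝ × E3 → ℝ)
    (hb : ContDiff ℝ (⊤ : ℕ∞) b) (hu : ContDiff ℝ (⊤ : ℕ∞) u) (hP0 : ContDiff ℝ (⊤ : ℕ∞) P0)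
    (hR : ∀ j, ContDiff ℝ (⊤ : ℕ∞) (R j)) :
    ksS v₀ (ksY2 p P0 R b u) =
      (∫ ω : sphere (0:E3) 1, ksF2 p P0 R b u (v₀, (ω:E3)) ∂sphMeasure) := by
  have hbd : Differentiable ℝ b := hb.differentiable (by simp)
  have hud : Differentiable ℝ u := hu.differentiable (by simp)
  have hPd : Differentiable ℝ P0 := hP0.differentiable (by simp)
  have hRd : ∀ j, Differentiable ℝ (R j) := fun j => (hR j).differentiable (by simp)
  have c1 := hb.continuous
  have c2 := hu.continuous
  have c3 : Continuous (fderiv ℝ b) := hb.continuous_fderiv (by simp)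
  have c4 : Continuous (fderiv ℝ u) := hu.continuous_fderiv (by simp)
  have c5 : Continuous (fderiv ℝ P0) := hP0.continuous_fderiv (by simp)
  have c6 := ks_continuous_nullGen p
  have c7 := hP0.continuous
  have c8 : ∀ j, Continuous (R j) := fun j => (hR j).continuous
  have c9 : ∀ j, Continuous (fderiv ℝ (R j)) := fun j => (hR j).continuous_fderiv (by simp)
  have hw : Continuous (ksPw p R) := by unfold ksPw; fun_prop
  have hPb : Continuous (ksPb p P0 R) := by unfold ksPb; fun_prop
  have hPbL : Continuous (ksPbL p P0 R) := by unfold ksPbL; fun_prop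
  have h0 : ∫ ω : sphere (0:E3) 1, ksF2 p P0 R b u (0, (ω:E3)) ∂sphMeasure = 0 := by simp [ksF2]
  have hg := ks_general v₀ hv (ksF2 p P0 R b u) (ksX2 p P0 R b u) (ksT2 p R b u)
    (by unfold ksF2; fun_prop) (by unfold ksX2; fun_prop) (by unfold ksT2; fun_prop) ?_ ?_
  · rw [h0, sub_zero] at hg
    rw [← hg]
    congr 1
    funext q
    exact (ks_alg2 p P0 R b u q).symm
  · intro v ω
    have h1 := ks_b_v b hbd v ω
    have h2 := ks_comp_v u hud p v ω
    have h3 : HasDerivAt (fun w => ksPb p P0 R (w, ω)) (ksPbL p P0 R (v, ω)) v := by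
      unfold ksPb ksPw ksPbL
      exact (ks_comp_v P0 hPd p v ω).fun_neg.fun_sub
        (HasDerivAt.fun_sum fun j _ => (ks_comp_v (R j) (hRd j) p v ω).const_mul (ω j))
    have h4 := ((hasDerivAt_id' v).fun_mul ((h3.fun_mul h1).fun_mul h2)).const_mul (-(1/2) : ℝ)
    unfold ksF2 ksX2
    refine ks_hd_congr h4 ?_
    simp only []
    ring
  · intro v
    have h := ks_tangential_div (fun j y => b (v, y) * R j (nullGen p v y) * u (nullGen p v y))
      (fun j => by
        have h1 := (ks_contDiff_nullGen p (n := 1)).comp (contDiff_prodMk_right v)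
        have h2 := (hb.of_le (m := 1) (by simp)).comp (contDiff_prodMk_right v)
        exact (h2.mul (((hR j).of_le (m := 1) (by simp)).comp h1)).mul
          ((hu.of_le (m := 1) (by simp)).comp h1))
    rw [← h]
    refine integral_congr_ae (.of_forall fun ω => ?_)
    unfold ksT2
    refine Finset.sum_congr rfl fun j _ => ?_
    have hd : ∀ e : E3, fderiv ℝ (fun y => b (v, y) * R j (nullGen p v y) * u (nullGen p v y))
        (ω:E3) e =
        fderiv ℝ b (v, (ω:E3)) (0, e) * R j (nullGen p v ω) * u (nullGen p v ω)
      + b (v, (ω:E3)) * (v * fderiv ℝ (R j) (nullGen p v ω) (0, e)) * u (nullGen p v ω)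
      + b (v, (ω:E3)) * R j (nullGen p v ω) * (v * fderiv ℝ u (nullGen p v ω) (0, e)) := by
      intro e
      have h1 := ks_b_ω b hbd v ω
      rw [((h1.fun_mul (ks_comp_ω (R j) (hRd j) p v ω)).fun_mul (ks_comp_ω u hud p v ω)).fderiv]
      have hs : ∀ A : ℝ × E3 →L[ℝ] ℝ, A (0, v • e) = v * A (0, e) := by
        intro A
        rw [← smul_eq_mul, ← map_smul]; simp
      simp [hs]
      ring
    rw [hd, hd]


lemma ks_inner (x y : E3) : ⟪x, y⟫ = ∑ j : Fin 3, x j * y j := by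
  rw [PiLp.inner_apply]
  refine Finset.sum_congr rfl fun j _ => ?_
  simp [mul_comm]

/-- Time component. -/
def ksP0 (P : ℝ × E3 → ℝ × E3) (q : ℝ × E3) : ℝ := (P q).1
/-- Space components. -/
def ksR (P : ℝ × E3 → ℝ × E3) (j : Fin 3) (q : ℝ × E3) : ℝ := (P q).2 j

lemma ks_contDiff_P0 (P : ℝ × E3 → ℝ × E3) (hP : ContDiff ℝ (⊤ : ℕ∞) P) :
    ContDiff ℝ (⊤ : ℕ∞) (ksP0 P) := hP.fst

lemma ks_contDiff_R (P : ℝ × E3 → ℝ × E3) (hP : ContDiff ℝ (⊤ : ℕ∞) P) (j : Fin 3) :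
    ContDiff ℝ (⊤ : ℕ∞) (ksR P j) :=
  contDiff_euclidean.1 hP.snd j

lemma ks_PL (P : ℝ × E3 → ℝ × E3) (p : ℝ × E3) (v : ℝ) (ω : E3) :
    PL P (nullGen p v ω) ω = ksPl p (ksP0 P) (ksR P) (v, ω) := by
  rw [PL, ks_inner]; rfl

lemma ks_PLbar (P : ℝ × E3 → ℝ × E3) (p : ℝ × E3) (v : ℝ) (ω : E3) :
    PLbar P (nullGen p v ω) ω = ksPb p (ksP0 P) (ksR P) (v, ω) := by
  rw [PLbar, ks_inner]; rfl

lemma ks_Pb_v (p : ℝ × E3) (P0 : ℝ × E3 → ℝ) (R : Fin 3 → ℝ × E3 → ℝ)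
    (hPd : Differentiable ℝ P0) (hRd : ∀ j, Differentiable ℝ (R j)) (v : ℝ) (ω : E3) :
    HasDerivAt (fun w => ksPb p P0 R (w, ω)) (ksPbL p P0 R (v, ω)) v := by
  unfold ksPb ksPw ksPbL
  exact (ks_comp_v P0 hPd p v ω).fun_neg.fun_sub
    (HasDerivAt.fun_sum fun j _ => (ks_comp_v (R j) (hRd j) p v ω).const_mul (ω j))

lemma ks_fderiv_slice (u : ℝ × E3 → ℝ) (hu : Differentiable ℝ u) (q : ℝ × E3) (e : E3) :
    fderiv ℝ (fun y => u (q.1, y)) q.2 e = fderiv ℝ u q (0, e) := by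
  rw [(ks_b_ω u hu q.1 q.2).fderiv]
  simp

lemma ks_slashDivP (P : ℝ × E3 → ℝ × E3) (hP : ContDiff ℝ (⊤ : ℕ∞) P) (p : ℝ × E3) (v : ℝ)
    (hv : v ≠ 0) (ω : E3) :
    v * slashDivP P (nullGen p v ω) ω v = ksDiv p (ksR P) (v, ω) := by
  have h : ∀ i e, fderiv ℝ (fun y => (P ((nullGen p v ω).1, y)).2 i) (nullGen p v ω).2 e
      = fderiv ℝ (ksR P i) (nullGen p v ω) (0, e) := fun i e =>
    ks_fderiv_slice (ksR P i) ((ks_contDiff_R P hP i).differentiable (by simp)) _ e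
  have h2 : ⟪ω, (P (nullGen p v ω)).2⟫ = ksPw p (ksR P) (v, ω) := by rw [ks_inner]; rfl
  unfold slashDivP ksDiv
  rw [h2]
  simp only [h]
  rw [mul_sub]
  congr 1
  field_simp

lemma ks_dt (u : ℝ × E3 → ℝ) (hu : Differentiable ℝ u) (q : ℝ × E3) :
    dt u q = fderiv ℝ u q (1, 0) := (ks_b_v u hu q.1 q.2).deriv

lemma ks_gradx (u : ℝ × E3 → ℝ) (hu : Differentiable ℝ u) (q : ℝ × E3) (x : E3) :
    ⟪x, gradx u q⟫ = fderiv ℝ u q (0, x) := by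
  rw [real_inner_comm, gradx, gradient, InnerProductSpace.toDual_symm_apply, ks_fderiv_slice u hu]

lemma ks_Lbar (u : ℝ × E3 → ℝ) (hu : Differentiable ℝ u) (q : ℝ × E3) (ω : E3) :
    Lbar u q ω = fderiv ℝ u q (-1, -ω) := by
  rw [Lbar, ks_dt u hu, ks_gradx u hu, ks_split _ (-1), ks_neg]; ring

lemma ks_box (u : ℝ × E3 → ℝ) (hu : ContDiff ℝ (⊤ : ℕ∞) u) (q : ℝ × E3) :
    -(dt (dt u) q) + lap (fun y => u (q.1, y)) q.2 = ksBox u q := by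
  have hud : Differentiable ℝ u := hu.differentiable (by simp)
  have hu1 : ContDiff ℝ (⊤ : ℕ∞) (fderiv ℝ u) := hu.fderiv_right (by simp)
  have hudd : Differentiable ℝ (fderiv ℝ u) := hu1.differentiable (by simp)
  have hev : ∀ a : ℝ × E3, Differentiable ℝ (fun q => fderiv ℝ u q a) := fun a => by fun_prop
  have hev2 : ∀ (a c : ℝ × E3), fderiv ℝ (fun q => fderiv ℝ u q a) q c =
      fderiv ℝ (fderiv ℝ u) q c a := by
    intro a c
    have := (hudd q).hasFDerivAt.clm_apply (hasFDerivAt_const a q)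
    rw [this.fderiv]
    simp
  have h1 : dt u = fun q => fderiv ℝ u q (1, 0) := funext fun q => ks_dt u hud q
  rw [h1, ks_dt _ (hev _), hev2, ksBox, lap]
  congr 1
  refine Finset.sum_congr rfl fun i _ => ?_
  have h2 : (fun y => fderiv ℝ (fun y => u (q.1, y)) y (EuclideanSpace.single i 1)) =
      fun y => (fun q => fderiv ℝ u q (0, EuclideanSpace.single i 1)) (q.1, y) :=
    funext fun y => ks_fderiv_slice u hud (q.1, y) _
  rw [h2, ks_fderiv_slice _ (hev _), hev2]

lemma ks_sgc (b : ℝ → E3 → ℝ) (hb : Differentiable ℝ (fun q : ℝ × E3 => b q.1 q.2))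
    (v : ℝ) (hv : 0 < v) (ω y : E3) (hω : ‖ω‖ = 1) (hy : ⟪ω, y⟫ = 0) :
    v ^ 2 * ⟪slashGradCone (fun w η => b w η / w) v ω, y⟫ =
      fderiv ℝ (fun q : ℝ × E3 => b q.1 q.2) (v, ω) (0, y) := by
  have h0 : ω ≠ 0 := by rintro rfl; simp at hω
  obtain ⟨N, hN, hNe⟩ := ks_normalize_hasFDerivAt ω h0
  have hNy : N y = y := by rw [hNe]; simp [hω, hy]
  have hnw : ‖ω‖⁻¹ • ω = ω := by simp [hω]
  have h1 := ks_b_ω (fun q : ℝ × E3 => b q.1 q.2) hb v (‖ω‖⁻¹ • ω)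
  have h2 := HasFDerivAt.comp (g := fun y => b v y) (f := fun y : E3 => ‖y‖⁻¹ • y) ω h1 hN
  have h3 := h2.mul_const (v⁻¹)
  rw [slashGradCone, real_inner_smul_left, gradient, InnerProductSpace.toDual_symm_apply]
  have h4 : fderiv ℝ (fun x => b v (‖x‖⁻¹ • x) / v) ω = _ := HasFDerivAt.fderiv h3
  rw [h4, hnw]
  simp [hNy]
  field_simp

lemma ks_K2 (b : ℝ → E3 → ℝ) (hb : Differentiable ℝ (fun q : ℝ × E3 => b q.1 q.2))
    (u : ℝ × E3 → ℝ) (hu : Differentiable ℝ u) (p : ℝ × E3)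
    (v : ℝ) (hv : 0 < v) (ω : E3) (hω : ‖ω‖ = 1) :
    v ^ 2 * ⟪slashGradCone (fun w η => b w η / w) v ω, slashGradSpace u (nullGen p v ω) ω⟫ =
      ksK2 p (fun q : ℝ × E3 => b q.1 q.2) u (v, ω) := by
  have hg : ∀ j, (gradx u (nullGen p v ω)) j =
      fderiv ℝ u (nullGen p v ω) (0, EuclideanSpace.single j 1) := fun j => by
    rw [← ks_gradx u hu]; simp [EuclideanSpace.inner_single_left]
  rw [ks_sgc b hb v hv ω _ hω]
  · rw [slashGradSpace, ks_gradx u hu]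
    have : ((0:ℝ), gradx u (nullGen p v ω) - fderiv ℝ u (nullGen p v ω) (0, ω) • ω) =
      (0, gradx u (nullGen p v ω)) - fderiv ℝ u (nullGen p v ω) (0, ω) • (0, ω) := by simp
    rw [this, map_sub, map_smul, ks_sum_coord _ (gradx u (nullGen p v ω)), ksK2]
    simp only [hg, smul_eq_mul]
    congr 1
    · exact Finset.sum_congr rfl fun j _ => mul_comm _ _
    · exact mul_comm _ _
  · simp [slashGradSpace, inner_sub_right, inner_smul_right, hω]

lemma ks_K3 (b : ℝ → E3 → ℝ) (hb : Differentiable ℝ (fun q : ℝ × E3 => b q.1 q.2))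
    (u : ℝ × E3 → ℝ) (P : ℝ × E3 → ℝ × E3) (p : ℝ × E3)
    (v : ℝ) (hv : 0 < v) (ω : E3) (hω : ‖ω‖ = 1) :
    v ^ 2 * (⟪Ptan P (nullGen p v ω) ω, slashGradCone (fun w η => b w η / w) v ω⟫
      * u (nullGen p v ω)) =
      ksK3 p (ksR P) (fun q : ℝ × E3 => b q.1 q.2) u (v, ω) := by
  have h2 : ⟪ω, (P (nullGen p v ω)).2⟫ = ksPw p (ksR P) (v, ω) := by rw [ks_inner]; rfl
  rw [real_inner_comm, ← mul_assoc, ks_sgc b hb v hv ω _ hω]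
  · rw [Ptan, h2, ksK3]
    have : ((0:ℝ), (P (nullGen p v ω)).2 - ksPw p (ksR P) (v, ω) • ω) =
      (0, (P (nullGen p v ω)).2) - ksPw p (ksR P) (v, ω) • (0, ω) := by simp
    rw [this, map_sub, map_smul, ks_sum_coord _ (P (nullGen p v ω)).2]
    rfl
  · simp [Ptan, inner_sub_right, inner_smul_right, hω]

lemma ks_FO (P : ℝ × E3 → ℝ × E3) (u : ℝ × E3 → ℝ) (hu : Differentiable ℝ u) (p : ℝ × E3)
    (v : ℝ) (ω : E3) :
    -(P (nullGen p v ω)).1 * dt u (nullGen p v ω) + ⟪(P (nullGen p v ω)).2, gradx u (nullGen p v ω)⟫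
    = -(1/2) * ksPb p (ksP0 P) (ksR P) (v, ω) * fderiv ℝ u (nullGen p v ω) (-1, ω)
      -(1/2) * ksPl p (ksP0 P) (ksR P) (v, ω) * fderiv ℝ u (nullGen p v ω) (-1, -ω)
      + ((∑ j : Fin 3, ksR P j (nullGen p v ω) *
      fderiv ℝ u (nullGen p v ω) (0, EuclideanSpace.single j 1))
      - ksPw p (ksR P) (v, ω) * fderiv ℝ u (nullGen p v ω) (0, ω)) := by
  rw [ks_dt u hu, ks_gradx u hu, ks_sum_coord _ (P (nullGen p v ω)).2, ks_split _ (-1) ω,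
    ks_split _ (-1) (-ω), ks_neg]
  unfold ksPb ksPl ksP0 ksR
  ring

lemma ks_algebra (n : ℕ) (v : ℝ) (b b' u Lu Lb box ψ : Fin n → ℝ) (pl pb W : Fin n → Fin n → ℝ)
    (hw : ∀ m, box m + ∑ c, (-(1/2) * pb m c * Lu c - (1/2) * pl m c * Lb c + W m c) = ψ m)
    (ht : ∀ m, b' m = (1/2) * ∑ c, pl c m * b c) :
    (∑ m, (b' m * u m - v * (b' m * Lb m) + v * b m * box m))
    + (∑ m, ∑ c, (-(1/2) * (v * (pb c m * b' c * u m)) - (1/2) * (v * (pb c m * b c * Lu m))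
        + v * b c * W c m - (1/2) * (pl c m * b c * u m)
        + (1/4) * (v * ((∑ d, pl c d * pb d m) * b c * u m))))
    = ∑ m, v * b m * ψ m := by
  have A : ∑ m, b' m * u m = ∑ m, ∑ c, (1/2) * (pl c m * b c * u m) := by
    refine Finset.sum_congr rfl fun m _ => ?_
    rw [ht, Finset.mul_sum, Finset.sum_mul]
    exact Finset.sum_congr rfl fun c _ => by ring
  have B : ∑ m, v * (b' m * Lb m) = ∑ m, ∑ c, (1/2) * (v * (pl c m * b c * Lb m)) := by
    refine Finset.sum_congr rfl fun m _ => ?_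
    rw [ht, Finset.mul_sum, Finset.sum_mul, Finset.mul_sum]
    exact Finset.sum_congr rfl fun c _ => by ring
  have C : ∑ m, v * b m * ψ m = ∑ m, v * b m * box m +
      ∑ m, ∑ c, v * b c * (-(1/2) * pb c m * Lu m - (1/2) * pl c m * Lb m + W c m) := by
    rw [Finset.sum_comm, ← Finset.sum_add_distrib]
    refine Finset.sum_congr rfl fun m _ => ?_
    rw [← hw, mul_add, Finset.mul_sum]
  have D : ∑ m, ∑ c, (1/2) * (v * (pb c m * b' c * u m)) =
      ∑ m, ∑ c, (1/4) * (v * ((∑ d, pl c d * pb d m) * b c * u m)) := by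
    refine Finset.sum_congr rfl fun m _ => ?_
    have h1 : ∀ c, (1/2) * (v * (pb c m * b' c * u m)) =
        ∑ d, (1/4) * v * pb c m * pl d c * b d * u m := by
      intro c
      rw [ht, Finset.mul_sum, Finset.mul_sum, Finset.sum_mul, Finset.mul_sum, Finset.mul_sum]
      exact Finset.sum_congr rfl fun d _ => by ring
    have h2 : ∀ c, (1/4) * (v * ((∑ d, pl c d * pb d m) * b c * u m)) =
        ∑ d, (1/4) * v * pb d m * pl c d * b c * u m := by
      intro c
      rw [Finset.sum_mul, Finset.sum_mul, Finset.mul_sum, Finset.mul_sum]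
      exact Finset.sum_congr rfl fun d _ => by ring
    simp only [h1, h2]
    exact Finset.sum_comm
  have E : ∑ m, ∑ c, (-(1/2) * (v * (pb c m * b' c * u m)) - (1/2) * (v * (pb c m * b c * Lu m))
        + v * b c * W c m - (1/2) * (pl c m * b c * u m)
        + (1/4) * (v * ((∑ d, pl c d * pb d m) * b c * u m)))
      = (∑ m, ∑ c, v * b c * (-(1/2) * pb c m * Lu m - (1/2) * pl c m * Lb m + W c m))
        + (∑ m, ∑ c, (1/2) * (v * (pl c m * b c * Lb m)))
        - (∑ m, ∑ c, (1/2) * (v * (pb c m * b' c * u m)))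
        - (∑ m, ∑ c, (1/2) * (pl c m * b c * u m))
        + ∑ m, ∑ c, (1/4) * (v * ((∑ d, pl c d * pb d m) * b c * u m)) := by
    simp only [← Finset.sum_add_distrib, ← Finset.sum_sub_distrib]
    exact Finset.sum_congr rfl fun m _ => Finset.sum_congr rfl fun c _ => by ring
  rw [E, C, D, Finset.sum_add_distrib, Finset.sum_sub_distrib, A, B]
  ring


/-- Weighted `ν` term. -/
def ksK4 {n : ℕ} (P : Fin n → Fin n → ℝ × E3 → ℝ × E3) (c m : Fin n) (p : ℝ × E3)
    (b u : ℝ × E3 → ℝ) (q : ℝ × E3) : ℝ :=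
  (-ksDiv p (ksR (P c m)) q + (1/2) * (q.1 * ksPbL p (ksP0 (P c m)) (ksR (P c m)) q)
    + (1/2) * ksPb p (ksP0 (P c m)) (ksR (P c m)) q
    - (1/2) * ksPl p (ksP0 (P c m)) (ksR (P c m)) q
    + (1/4) * (q.1 * ∑ d : Fin n, ksPl p (ksP0 (P c d)) (ksR (P c d)) q
      * ksPb p (ksP0 (P d m)) (ksR (P d m)) q)) * b q * u (nullGen p q.1 q.2)

lemma ks_K4 {n : ℕ} (P : Fin n → Fin n → ℝ × E3 → ℝ × E3)
    (hP : ∀ m c, ContDiff ℝ (⊤ : ℕ∞) (P m c)) (c m : Fin n) (p : ℝ × E3)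
    (b : ℝ → E3 → ℝ) (u : ℝ × E3 → ℝ) (v : ℝ) (hv : 0 < v) (ω : E3) :
    v ^ 2 * (nuSys P c m p v ω * (b v ω / v) * u (nullGen p v ω)) =
      ksK4 P c m p (fun q : ℝ × E3 => b q.1 q.2) u (v, ω) := by
  have hd := (ks_Pb_v p (ksP0 (P c m)) (ksR (P c m))
    ((ks_contDiff_P0 _ (hP c m)).differentiable (by simp))
    (fun j => (ks_contDiff_R _ (hP c m) j).differentiable (by simp)) v ω).deriv
  have hs := ks_slashDivP (P c m) (hP c m) p v hv.ne' ω
  unfold nuSys ksK4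
  simp only [ks_PL, ks_PLbar, hd]
  rw [← hs]
  field_simp

lemma ks_cont_all (p : ℝ × E3) (P0 : ℝ × E3 → ℝ) (R : Fin 3 → ℝ × E3 → ℝ)
    (b u : ℝ × E3 → ℝ)
    (hb : ContDiff ℝ (⊤ : ℕ∞) b) (hu : ContDiff ℝ (⊤ : ℕ∞) u) (hP0 : ContDiff ℝ (⊤ : ℕ∞) P0)
    (hR : ∀ j, ContDiff ℝ (⊤ : ℕ∞) (R j)) :
    Continuous (ksPl p P0 R) ∧ Continuous (ksPb p P0 R) ∧ Continuous (ksPbL p P0 R)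
    ∧ Continuous (ksDiv p R) ∧ Continuous (ksK3 p R b u) ∧ Continuous (ksY2 p P0 R b u) := by
  have c1 := hb.continuous
  have c2 := hu.continuous
  have c3 : Continuous (fderiv ℝ b) := hb.continuous_fderiv (by simp)
  have c4 : Continuous (fderiv ℝ u) := hu.continuous_fderiv (by simp)
  have c5 : Continuous (fderiv ℝ P0) := hP0.continuous_fderiv (by simp)
  have c6 := ks_continuous_nullGen p
  have c7 := hP0.continuous
  have c8 : ∀ j, Continuous (R j) := fun j => (hR j).continuous
  have c9 : ∀ j, Continuous (fderiv ℝ (R j)) := fun j => (hR j).continuous_fderiv (by simp)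
  have hw : Continuous (ksPw p R) := by unfold ksPw; fun_prop
  have hPb : Continuous (ksPb p P0 R) := by unfold ksPb; fun_prop
  have hPl : Continuous (ksPl p P0 R) := by unfold ksPl; fun_prop
  have hPbL : Continuous (ksPbL p P0 R) := by unfold ksPbL; fun_prop
  have hD : Continuous (ksDiv p R) := by unfold ksDiv; fun_prop
  have hK : Continuous (ksK3 p R b u) := by unfold ksK3; fun_prop
  refine ⟨hPl, hPb, hPbL, hD, hK, ?_⟩
  unfold ksY2 ksX2
  fun_prop

lemma ks_cont_one (p : ℝ × E3) (b u : ℝ × E3 → ℝ)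
    (hb : ContDiff ℝ (⊤ : ℕ∞) b) (hu : ContDiff ℝ (⊤ : ℕ∞) u) :
    Continuous (ksZ1 p b u) ∧ Continuous (ksK2 p b u) := by
  have c1 := hb.continuous
  have c2 := hu.continuous
  have hu1 : ContDiff ℝ (⊤ : ℕ∞) (fderiv ℝ u) := hu.fderiv_right (by simp)
  have c3 : Continuous (fderiv ℝ b) := hb.continuous_fderiv (by simp)
  have c4 : Continuous (fderiv ℝ u) := hu.continuous_fderiv (by simp)
  have c5 : Continuous (fderiv ℝ (fderiv ℝ u)) := hu1.continuous_fderiv (by simp)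
  have c6 := ks_continuous_nullGen p
  constructor
  · unfold ksZ1 ksBox; fun_prop
  · unfold ksK2; fun_prop

lemma ks_cont_K4 {n : ℕ} (P : Fin n → Fin n → ℝ × E3 → ℝ × E3)
    (hP : ∀ m c, ContDiff ℝ (⊤ : ℕ∞) (P m c)) (c m : Fin n) (p : ℝ × E3) (b u : ℝ × E3 → ℝ)
    (hb : ContDiff ℝ (⊤ : ℕ∞) b) (hu : ContDiff ℝ (⊤ : ℕ∞) u) :
    Continuous (ksK4 P c m p b u) := by
  have c1 := hb.continuous
  have c2 := hu.continuous
  have c6 := ks_continuous_nullGen p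
  have h := fun c m => ks_cont_all p (ksP0 (P c m)) (ksR (P c m)) b u hb hu
    (ks_contDiff_P0 _ (hP c m)) (ks_contDiff_R _ (hP c m))
  have h1 := fun c m => (h c m).1
  have h2 := fun c m => (h c m).2.1
  have h3 := (h c m).2.2.1
  have h4 := (h c m).2.2.2.1
  unfold ksK4
  fun_prop

lemma ks_pointwise {n : ℕ}
    (Φ Ψ : Fin n → ℝ × E3 → ℝ) (P : Fin n → Fin n → ℝ × E3 → ℝ × E3)
    (hΦ : ∀ m, ContDiff ℝ (⊤ : ℕ∞) (Φ m))
    (hwave : ∀ m : Fin n, ∀ q : ℝ × E3,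
      -(dt (dt (Φ m)) q) + lap (fun y => Φ m (q.1, y)) q.2
        + ∑ c : Fin n, (-(P m c q).1 * dt (Φ c) q + ⟪(P m c q).2, gradx (Φ c) q⟫)
      = Ψ m q)
    (p : ℝ × E3) (v : ℝ) (ω : E3) (B : Fin n → ℝ → E3 → ℝ)
    (hB : ∀ m, ContDiff ℝ (⊤ : ℕ∞) (fun q : ℝ × E3 => B m q.1 q.2))
    (hT : ∀ m : Fin n, deriv (fun w => B m w ω) v
        = (1/2) * ∑ c : Fin n, PL (P c m) (nullGen p v ω) ω * B c v ω) :
    (∑ m, ksZ1 p (fun q => B m q.1 q.2) (Φ m) (v, ω))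
    + (∑ m, ∑ c, ((ksY2 p (ksP0 (P c m)) (ksR (P c m)) (fun q => B c q.1 q.2) (Φ m) (v, ω)
      - ksK3 p (ksR (P c m)) (fun q => B c q.1 q.2) (Φ m) (v, ω))
      + ksK4 P c m p (fun q => B c q.1 q.2) (Φ m) (v, ω)))
    = ∑ m, v * B m v ω * Ψ m (nullGen p v ω) := by
  have hΦd : ∀ m, Differentiable ℝ (Φ m) := fun m => (hΦ m).differentiable (by simp)
  have hBd : ∀ m, Differentiable ℝ (fun q : ℝ × E3 => B m q.1 q.2) :=
    fun m => (hB m).differentiable (by simp)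
  have h := ks_algebra n v (fun m => B m v ω)
    (fun m => fderiv ℝ (fun q : ℝ × E3 => B m q.1 q.2) (v, ω) (1, 0))
    (fun m => Φ m (nullGen p v ω))
    (fun m => fderiv ℝ (Φ m) (nullGen p v ω) (-1, ω))
    (fun m => fderiv ℝ (Φ m) (nullGen p v ω) (-1, -ω))
    (fun m => ksBox (Φ m) (nullGen p v ω))
    (fun m => Ψ m (nullGen p v ω))
    (fun c m => ksPl p (ksP0 (P c m)) (ksR (P c m)) (v, ω))
    (fun c m => ksPb p (ksP0 (P c m)) (ksR (P c m)) (v, ω))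
    (fun c m => (∑ j : Fin 3, ksR (P c m) j (nullGen p v ω) *
      fderiv ℝ (Φ m) (nullGen p v ω) (0, EuclideanSpace.single j 1))
      - ksPw p (ksR (P c m)) (v, ω) * fderiv ℝ (Φ m) (nullGen p v ω) (0, ω)) ?_ ?_
  · rw [← h]
    congr 1
    refine Finset.sum_congr rfl fun m _ => Finset.sum_congr rfl fun c _ => ?_
    unfold ksY2 ksX2 ksK4
    ring
  · intro m
    rw [← hwave m (nullGen p v ω), ks_box _ (hΦ m)]
    congr 1
    exact Finset.sum_congr rfl fun c _ => (ks_FO (P m c) (Φ c) (hΦd c) p v ω).symm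
  · intro m
    have h1 := (ks_b_v _ (hBd m) v ω).deriv
    simp only at h1
    rw [← h1, hT]
    simp only [ks_PL]


/-- **Kirchhoff–Sobolev representation formula on the Minkowski backward null cone** for a
coupled system of `n` scalar wave equations with first-order terms (Minkowski scalar
instance of the paper's main theorem). -/
theorem kirchhoff_sobolev_minkowski_system
    (n : ℕ) (hn : 1 ≤ n)
    (Φ Ψ : Fin n → ℝ × E3 → ℝ) (P : Fin n → Fin n → ℝ × E3 → ℝ × E3)
    (hΦ : ∀ m, ContDiff ℝ (⊤ : ℕ∞) (Φ m)) (hΨ : ∀ m, ContDiff ℝ (⊤ : ℕ∞) (Ψ m))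
    (hP : ∀ m c, ContDiff ℝ (⊤ : ℕ∞) (P m c))
    (hwave : ∀ m : Fin n, ∀ q : ℝ × E3,
      -(dt (dt (Φ m)) q) + lap (fun y => Φ m (q.1, y)) q.2
        + ∑ c : Fin n, (-(P m c q).1 * dt (Φ c) q + ⟪(P m c q).2, gradx (Φ c) q⟫)
      = Ψ m q)
    (p : ℝ × E3) (v₀ : ℝ) (hv₀ : 0 < v₀)
    (J : Fin n → ℝ) (B : Fin n → ℝ → E3 → ℝ)
    (hB : ∀ m, ContDiff ℝ (⊤ : ℕ∞) (fun q : ℝ × E3 => B m q.1 q.2))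
    (hTransport : ∀ m : Fin n, ∀ v ∈ Set.Icc (0:ℝ) v₀, ∀ ω ∈ sphere (0 : E3) 1,
      deriv (fun w => B m w ω) v
        = (1/2) * ∑ c : Fin n, PL (P c m) (nullGen p v ω) ω * B c v ω)
    (hBinit : ∀ m : Fin n, ∀ ω ∈ sphere (0 : E3) 1, B m 0 ω = J m) :
    4 * π * ∑ m : Fin n, J m * Φ m p =
      -(∑ m : Fin n, coneInt v₀ (fun v ω => (B m v ω / v) * Ψ m (nullGen p v ω)))
      - (∑ m : Fin n, coneInt v₀ (fun v ω =>
          ⟪slashGradCone (fun w η => B m w η / w) v ω,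
            slashGradSpace (Φ m) (nullGen p v ω) ω⟫))
      - (∑ m : Fin n, ∑ c : Fin n, coneInt v₀ (fun v ω =>
          ⟪Ptan (P c m) (nullGen p v ω) ω, slashGradCone (fun w η => B c w η / w) v ω⟫
            * Φ m (nullGen p v ω)))
      + (∑ m : Fin n, ∑ c : Fin n, coneInt v₀ (fun v ω =>
          nuSys P c m p v ω * (B c v ω / v) * Φ m (nullGen p v ω)))
      + (∑ m : Fin n, v₀ * ∫ ω : sphere (0 : E3) 1,
          B m v₀ (ω : E3) *
            ((1/v₀) * Φ m (nullGen p v₀ (ω : E3))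
              - Lbar (Φ m) (nullGen p v₀ (ω : E3)) (ω : E3)) ∂sphMeasure)
      - (1/2) * (∑ m : Fin n, ∑ c : Fin n, v₀ * ∫ ω : sphere (0 : E3) 1,
          PLbar (P c m) (nullGen p v₀ (ω : E3)) (ω : E3) * B c v₀ (ω : E3)
            * Φ m (nullGen p v₀ (ω : E3)) ∂sphMeasure) := by
  set b : Fin n → ℝ × E3 → ℝ := fun m q => B m q.1 q.2 with hbdef
  have hΦd : ∀ m, Differentiable ℝ (Φ m) := fun m => (hΦ m).differentiable (by simp)
  have hBd : ∀ m, Differentiable ℝ (fun q : ℝ × E3 => B m q.1 q.2) :=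
    fun m => (hB m).differentiable (by simp)
  have hbc : ∀ m, ContDiff ℝ (⊤ : ℕ∞) (b m) := hB
  have kZ1 : ∀ m, Continuous (ksZ1 p (b m) (Φ m)) := fun m => (ks_cont_one p _ _ (hbc m) (hΦ m)).1
  have kK2 : ∀ m, Continuous (ksK2 p (b m) (Φ m)) := fun m => (ks_cont_one p _ _ (hbc m) (hΦ m)).2
  have kall := fun m c => ks_cont_all p (ksP0 (P c m)) (ksR (P c m)) (b c) (Φ m) (hbc c) (hΦ m)
    (ks_contDiff_P0 _ (hP c m)) (ks_contDiff_R _ (hP c m))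
  have kK3 := fun m c => (kall m c).2.2.2.2.1
  have kY2 := fun m c => (kall m c).2.2.2.2.2
  have kK4 := fun m c => ks_cont_K4 P hP c m p (b c) (Φ m) (hbc c) (hΦ m)
  have kK1 : ∀ m, Continuous (fun q : ℝ × E3 => q.1 * b m q * Ψ m (nullGen p q.1 q.2)) := by
    intro m
    have c1 := (hbc m).continuous
    have c2 := (hΨ m).continuous
    have c6 := ks_continuous_nullGen p
    fun_prop
  have e1 : ∀ m, coneInt v₀ (fun v ω => (B m v ω / v) * Ψ m (nullGen p v ω)) =
      ksS v₀ (fun q => q.1 * b m q * Ψ m (nullGen p q.1 q.2)) := fun m =>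
    ks_coneInt v₀ hv₀ _ _ fun v hv ω _ => by
      simp only [hbdef]
      field_simp
  have e2 : ∀ m, coneInt v₀ (fun v ω =>
          ⟪slashGradCone (fun w η => B m w η / w) v ω,
            slashGradSpace (Φ m) (nullGen p v ω) ω⟫) = ksS v₀ (ksK2 p (b m) (Φ m)) := fun m =>
    ks_coneInt v₀ hv₀ _ _ fun v hv ω hω => ks_K2 (B m) (hBd m) (Φ m) (hΦd m) p v hv ω hω
  have e3 : ∀ m c, coneInt v₀ (fun v ω =>
          ⟪Ptan (P c m) (nullGen p v ω) ω, slashGradCone (fun w η => B c w η / w) v ω⟫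
            * Φ m (nullGen p v ω)) = ksS v₀ (ksK3 p (ksR (P c m)) (b c) (Φ m)) := fun m c =>
    ks_coneInt v₀ hv₀ _ _ fun v hv ω hω => ks_K3 (B c) (hBd c) (Φ m) (P c m) p v hv ω hω
  have e4 : ∀ m c, coneInt v₀ (fun v ω =>
          nuSys P c m p v ω * (B c v ω / v) * Φ m (nullGen p v ω)) =
      ksS v₀ (ksK4 P c m p (b c) (Φ m)) := fun m c =>
    ks_coneInt v₀ hv₀ _ _ fun v hv ω _ => ks_K4 P hP c m p (B c) (Φ m) v hv ω
  have e5 : ∀ m, v₀ * ∫ ω : sphere (0 : E3) 1,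
          B m v₀ (ω : E3) *
            ((1/v₀) * Φ m (nullGen p v₀ (ω : E3))
              - Lbar (Φ m) (nullGen p v₀ (ω : E3)) (ω : E3)) ∂sphMeasure =
      ∫ ω : sphere (0 : E3) 1, ksF1 p (b m) (Φ m) (v₀, (ω:E3)) ∂sphMeasure := by
    intro m
    rw [← integral_const_mul]
    refine integral_congr_ae (.of_forall fun ω => ?_)
    simp only [ks_Lbar _ (hΦd m), ksF1, hbdef]
    field_simp
  have e6 : ∀ m c, v₀ * ∫ ω : sphere (0 : E3) 1,
          PLbar (P c m) (nullGen p v₀ (ω : E3)) (ω : E3) * B c v₀ (ω : E3)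
            * Φ m (nullGen p v₀ (ω : E3)) ∂sphMeasure =
      -2 * ∫ ω : sphere (0 : E3) 1,
        ksF2 p (ksP0 (P c m)) (ksR (P c m)) (b c) (Φ m) (v₀, (ω:E3)) ∂sphMeasure := by
    intro m c
    rw [← integral_const_mul, ← integral_const_mul]
    refine integral_congr_ae (.of_forall fun ω => ?_)
    simp only [ks_PLbar, ksF2, hbdef]
    ring
  have e7 : ∀ m, ∫ ω : sphere (0 : E3) 1, ksF1 p (b m) (Φ m) (0, (ω:E3)) ∂sphMeasure =
      4 * π * (J m * Φ m p) := by
    intro m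
    rw [← ks_total]
    refine integral_congr_ae (.of_forall fun ω => ?_)
    simp [ksF1, hbdef, nullGen, hBinit m ω ω.2]
  have p1 : ∀ m, ksS v₀ (ksZ1 p (b m) (Φ m)) + ksS v₀ (ksK2 p (b m) (Φ m)) =
      (∫ ω : sphere (0 : E3) 1, ksF1 p (b m) (Φ m) (v₀, (ω:E3)) ∂sphMeasure)
        - 4 * π * (J m * Φ m p) := by
    intro m
    rw [← e7, ← ks_part1 v₀ hv₀ p _ _ (hbc m) (hΦ m), ksS_add v₀ hv₀ _ _ (kZ1 m) (kK2 m)]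
  have p2 := fun m c => ks_part2 v₀ hv₀ p (ksP0 (P c m)) (ksR (P c m)) (b c) (Φ m) (hbc c) (hΦ m)
    (ks_contDiff_P0 _ (hP c m)) (ks_contDiff_R _ (hP c m))
  have kZ2 : ∀ m c, Continuous (fun q => (ksY2 p (ksP0 (P c m)) (ksR (P c m)) (b c) (Φ m) q
      - ksK3 p (ksR (P c m)) (b c) (Φ m) q) + ksK4 P c m p (b c) (Φ m) q) :=
    fun m c => ((kY2 m c).sub (kK3 m c)).add (kK4 m c)
  have hz2 : ∀ m c, ksS v₀ (fun q => (ksY2 p (ksP0 (P c m)) (ksR (P c m)) (b c) (Φ m) q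
      - ksK3 p (ksR (P c m)) (b c) (Φ m) q) + ksK4 P c m p (b c) (Φ m) q) =
      ksS v₀ (ksY2 p (ksP0 (P c m)) (ksR (P c m)) (b c) (Φ m))
      - ksS v₀ (ksK3 p (ksR (P c m)) (b c) (Φ m)) + ksS v₀ (ksK4 P c m p (b c) (Φ m)) := by
    intro m c
    rw [← ksS_sub v₀ hv₀ _ _ (kY2 m c) (kK3 m c)]
    exact ksS_add v₀ hv₀ _ _ ((kY2 m c).sub (kK3 m c)) (kK4 m c)
  have main : (∑ m, ksS v₀ (ksZ1 p (b m) (Φ m)))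
      + (∑ m, ∑ c, (ksS v₀ (ksY2 p (ksP0 (P c m)) (ksR (P c m)) (b c) (Φ m))
      - ksS v₀ (ksK3 p (ksR (P c m)) (b c) (Φ m)) + ksS v₀ (ksK4 P c m p (b c) (Φ m))))
      = ∑ m, ksS v₀ (fun q => q.1 * b m q * Ψ m (nullGen p q.1 q.2)) := by
    simp only [← hz2]
    rw [← ksS_sum v₀ hv₀ _ _ kZ1, ← ksS_sum v₀ hv₀ _ _ kK1]
    have i1 : ∀ m, _ := fun m => (ksS_sum v₀ hv₀ Finset.univ _ (kZ2 m)).symm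
    simp only [i1]
    have k3 : ∀ m, Continuous (fun q => ∑ c, ((ksY2 p (ksP0 (P c m)) (ksR (P c m)) (b c) (Φ m) q
      - ksK3 p (ksR (P c m)) (b c) (Φ m) q) + ksK4 P c m p (b c) (Φ m) q)) :=
      fun m => continuous_finsetSum _ fun c _ => kZ2 m c
    rw [← ksS_sum v₀ hv₀ _ _ k3, ← ksS_add v₀ hv₀ _ _ (continuous_finsetSum _ fun m _ => kZ1 m)
      (continuous_finsetSum _ fun m _ => k3 m)]
    refine ksS_congr v₀ hv₀ _ _ fun v hv ω hω => ?_
    exact ks_pointwise Φ Ψ P hΦ hwave p v ω B hB fun m => hTransport m v hv ω hω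
  simp only [e1, e2, e3, e4, e5, e6, ← p2]
  have hp1 := Finset.sum_congr (rfl : (Finset.univ : Finset (Fin n)) = Finset.univ)
    fun m _ => p1 m
  simp only [Finset.sum_add_distrib, Finset.sum_sub_distrib, ← Finset.mul_sum] at hp1 main ⊢
  linarith

end
end
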